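/- arXiv:1903.08021 — 2 statements merged into one kernel-verified Lean document; each statement's English description precedes it below -/
import Mathlib

section
/- Let X be a standard Gaussian vector in ℝ^n, f : ℝ^n → ℝ continuously differentiable with V = ∇f(ℝ^n), and assume f(·+h) is integrable against the standard Gaussian for all h. Define ψ(t) = inf{ ‖h‖_{ℓ^2}²/2 : E[f(X+h)] ≥ t, h ∈ ℝ^n }. Let t ∈ ℝ and δ > 0 be such that ψ(s) > ψ(t-δ) for all s > t-δ. If the Gaussian mean-width g(V) = E[ sup_{ξ∈V} ⟨ξ,Γ⟩ ] (Γ standard Gaussian on ℝ^n) satisfies g(V) ≤ δ/(2√2), then log P( f(X) ≥ t ) ≤ -ψ(t-δ). -/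
open MeasureTheory Real Set ENNReal ProbabilityTheory
open scoped Classical

/-- The standard Gaussian measure on `ℝⁿ`. -/
noncomputable def stdGaussian (n : ℕ) : Measure (Fin n → ℝ) :=
  Measure.pi fun _ : Fin n => gaussianReal 0 1

/-- The gradient of `f : ℝⁿ → ℝ` as a vector. -/
noncomputable def gradVec (n : ℕ) (f : (Fin n → ℝ) → ℝ) (y : Fin n → ℝ) : Fin n → ℝ :=
  fun i => fderiv ℝ f y (Pi.single i 1)

/-- The density of the standard Gaussian law on the line. -/
noncomputable def gaussDensity (x : ℝ) : ℝ := (√(2 * π))⁻¹ * exp (-x ^ 2 / 2)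

/-- The distribution function of the standard Gaussian law on the line. -/
noncomputable def gaussCDF (x : ℝ) : ℝ := ∫ t in Iic x, gaussDensity t

lemma gaussDensity_eq_gaussianPDFReal : gaussDensity = gaussianPDFReal 0 1 := by
  ext x
  simp [gaussDensity, gaussianPDFReal]

lemma gaussDensity_pos (x : ℝ) : 0 < gaussDensity x := by
  unfold gaussDensity; positivity

lemma gaussDensity_neg (x : ℝ) : gaussDensity (-x) = gaussDensity x := by
  simp [gaussDensity]

lemma continuous_gaussDensity : Continuous gaussDensity := by
  unfold gaussDensity; fun_prop

lemma hasDerivAt_gaussDensity (x : ℝ) : HasDerivAt gaussDensity (-x * gaussDensity x) x := by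
  unfold gaussDensity
  have h : HasDerivAt (fun y : ℝ => -y ^ 2 / 2) (-x) x := by
    have := ((hasDerivAt_pow 2 x).fun_neg).div_const 2
    exact this.congr_deriv (by simp; ring)
  exact ((h.exp).const_mul (√(2 * π))⁻¹).congr_deriv (by ring)

lemma integrable_gaussDensity : Integrable gaussDensity := by
  rw [gaussDensity_eq_gaussianPDFReal]; exact integrable_gaussianPDFReal 0 1

lemma integral_gaussDensity : ∫ x, gaussDensity x = 1 := by
  rw [gaussDensity_eq_gaussianPDFReal]; exact integral_gaussianPDFReal_eq_one 0 (by simp)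

lemma gaussianReal_real_eq_setIntegral (s : Set ℝ) :
    (gaussianReal 0 1).real s = ∫ x in s, gaussDensity x := by
  rw [Measure.real, gaussianReal_apply_eq_integral _ (by simp), ENNReal.toReal_ofReal,
    gaussDensity_eq_gaussianPDFReal]
  exact integral_nonneg fun x => gaussianPDFReal_nonneg _ _ _

lemma gaussCDF_eq_real (x : ℝ) : gaussCDF x = (gaussianReal 0 1).real (Iic x) :=
  (gaussianReal_real_eq_setIntegral _).symm

lemma gaussCDF_eq_cdf : gaussCDF = cdf (gaussianReal 0 1) := by
  ext x
  rw [gaussCDF_eq_real, cdf_eq_real]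

lemma hasDerivAt_gaussCDF (x : ℝ) : HasDerivAt gaussCDF (gaussDensity x) x := by
  have h : ∀ y, gaussCDF y = gaussCDF 0 + ∫ t in (0 : ℝ)..y, gaussDensity t := by
    intro y
    rw [← intervalIntegral.integral_Iic_sub_Iic integrable_gaussDensity.integrableOn
      integrable_gaussDensity.integrableOn]
    simp [gaussCDF]
  have h' : gaussCDF = fun y => gaussCDF 0 + ∫ t in (0 : ℝ)..y, gaussDensity t := funext h
  rw [h']
  exact (intervalIntegral.integral_hasDerivAt_right
    (integrable_gaussDensity.intervalIntegrable)
    (continuous_gaussDensity.stronglyMeasurableAtFilter _ _)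
    continuous_gaussDensity.continuousAt).const_add _

lemma continuous_gaussCDF : Continuous gaussCDF :=
  continuous_iff_continuousAt.2 fun x => (hasDerivAt_gaussCDF x).continuousAt

lemma strictMono_gaussCDF : StrictMono gaussCDF :=
  strictMono_of_hasDerivAt_pos hasDerivAt_gaussCDF gaussDensity_pos

lemma gaussCDF_neg (x : ℝ) : gaussCDF (-x) = 1 - gaussCDF x := by
  have h1 : gaussCDF (-x) = ∫ t in Ioi x, gaussDensity t := by
    unfold gaussCDF
    rw [← integral_comp_neg_Ioi]
    simp [gaussDensity_neg]
  have h2 := intervalIntegral.integral_Iic_add_Ioi (b := x)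
    integrable_gaussDensity.integrableOn integrable_gaussDensity.integrableOn
  rw [integral_gaussDensity] at h2
  rw [h1, gaussCDF]; linarith

lemma gaussCDF_zero : gaussCDF 0 = 1 / 2 := by
  have := gaussCDF_neg 0
  simp at this
  linarith

lemma tendsto_gaussCDF_atTop : Filter.Tendsto gaussCDF Filter.atTop (nhds 1) := by
  rw [gaussCDF_eq_cdf]; exact tendsto_cdf_atTop _

lemma tendsto_gaussCDF_atBot : Filter.Tendsto gaussCDF Filter.atBot (nhds 0) := by
  rw [gaussCDF_eq_cdf]; exact tendsto_cdf_atBot _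

lemma gaussCDF_mem (x : ℝ) : gaussCDF x ∈ Ioo (0 : ℝ) 1 := by
  have h0 : ∀ y, 0 ≤ gaussCDF y := fun y => by rw [gaussCDF_eq_real]; exact measureReal_nonneg
  have hpos : ∀ y, 0 < gaussCDF y := fun y =>
    (h0 (y - 1)).trans_lt (strictMono_gaussCDF (by linarith))
  refine ⟨hpos x, ?_⟩
  have := hpos (-x)
  rw [gaussCDF_neg] at this
  linarith

lemma gaussCDF_surj {p : ℝ} (hp : p ∈ Ioo (0 : ℝ) 1) : ∃ x, gaussCDF x = p := by
  obtain ⟨a, ha⟩ := (tendsto_gaussCDF_atBot.eventually (gt_mem_nhds hp.1)).exists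
  obtain ⟨b, hb⟩ := (tendsto_gaussCDF_atTop.eventually (lt_mem_nhds hp.2)).exists
  exact mem_range_of_exists_le_of_exists_ge continuous_gaussCDF ⟨a, ha.le⟩ ⟨b, hb.le⟩

/-- The quantile function of the standard Gaussian law. -/
noncomputable def gaussQuantile (p : ℝ) : ℝ := Function.invFun gaussCDF p

lemma gaussCDF_gaussQuantile {p : ℝ} (hp : p ∈ Ioo (0 : ℝ) 1) :
    gaussCDF (gaussQuantile p) = p :=
  Function.invFun_eq (gaussCDF_surj hp)

lemma gaussQuantile_gaussCDF (x : ℝ) : gaussQuantile (gaussCDF x) = x :=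
  Function.leftInverse_invFun strictMono_gaussCDF.injective x

lemma strictMonoOn_gaussQuantile : StrictMonoOn gaussQuantile (Ioo 0 1) := by
  intro p hp q hq hpq
  rw [← strictMono_gaussCDF.lt_iff_lt, gaussCDF_gaussQuantile hp, gaussCDF_gaussQuantile hq]
  exact hpq

lemma hasDerivAt_gaussQuantile {p : ℝ} (hp : p ∈ Ioo (0 : ℝ) 1) :
    HasDerivAt gaussQuantile (gaussDensity (gaussQuantile p))⁻¹ p := by
  have hs : Ioo (0 : ℝ) 1 ∈ nhds p := isOpen_Ioo.mem_nhds hp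
  have himg : gaussQuantile '' Ioo 0 1 = univ := by
    ext x
    simp only [mem_image, mem_univ, iff_true]
    exact ⟨gaussCDF x, gaussCDF_mem x, gaussQuantile_gaussCDF x⟩
  refine HasDerivAt.of_local_left_inverse (f := gaussCDF) ?_ (hasDerivAt_gaussCDF _)
    (gaussDensity_pos _).ne' ?_
  · exact strictMonoOn_gaussQuantile.continuousAt_of_image_mem_nhds hs
      (by rw [himg]; exact Filter.univ_mem)
  · filter_upwards [hs] with q hq using gaussCDF_gaussQuantile hq

/-- The Gaussian isoperimetric profile. -/
noncomputable def gaussProfile (p : ℝ) : ℝ := gaussDensity (gaussQuantile p)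

lemma gaussProfile_pos (p : ℝ) : 0 < gaussProfile p := gaussDensity_pos _

lemma hasDerivAt_gaussProfile {p : ℝ} (hp : p ∈ Ioo (0 : ℝ) 1) :
    HasDerivAt gaussProfile (-gaussQuantile p) p := by
  have := (hasDerivAt_gaussDensity (gaussQuantile p)).comp p (hasDerivAt_gaussQuantile hp)
  refine this.congr_deriv ?_
  rw [mul_assoc, mul_inv_cancel₀ (gaussDensity_pos _).ne', mul_one]

lemma gaussQuantile_one_sub {p : ℝ} (hp : p ∈ Ioo (0 : ℝ) 1) :
    gaussQuantile (1 - p) = -gaussQuantile p := by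
  rw [← gaussQuantile_gaussCDF (-gaussQuantile p), gaussCDF_neg, gaussCDF_gaussQuantile hp]

lemma gaussProfile_one_sub {p : ℝ} (hp : p ∈ Ioo (0 : ℝ) 1) :
    gaussProfile (1 - p) = gaussProfile p := by
  rw [gaussProfile, gaussQuantile_one_sub hp, gaussDensity_neg, gaussProfile]

lemma gaussQuantile_half : gaussQuantile (1 / 2) = 0 := by
  rw [← gaussCDF_zero, gaussQuantile_gaussCDF]

/-- The square of the Gaussian quantile function has increasing derivative. -/
lemma monotoneOn_deriv_sq_gaussQuantile :
    MonotoneOn (fun p => 2 * gaussQuantile p / gaussProfile p) (Ioo 0 1) := by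
  have hm : Monotone fun x : ℝ => 2 * x / gaussDensity x := by
    refine monotone_of_hasDerivAt_nonneg (f' := fun x => (2 + 2 * x ^ 2) / gaussDensity x) ?_ ?_
    · intro x
      have hx := (gaussDensity_pos x).ne'
      have := ((hasDerivAt_id x).const_mul 2).div (hasDerivAt_gaussDensity x) hx
      refine this.congr_deriv ?_
      simp only [id]
      field_simp
      ring
    · intro x
      have := gaussDensity_pos x
      simp only [Pi.zero_apply]
      positivity
  intro p hp q hq hpq
  exact hm (strictMonoOn_gaussQuantile.monotoneOn hp hq hpq)

lemma hasDerivAt_sq_gaussQuantile {p : ℝ} (hp : p ∈ Ioo (0 : ℝ) 1) :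
    HasDerivAt (fun q => gaussQuantile q ^ 2) (2 * gaussQuantile p / gaussProfile p) p := by
  have := (hasDerivAt_gaussQuantile hp).fun_pow 2
  exact this.congr_deriv (by simp [gaussProfile, div_eq_mul_inv])

lemma convexOn_sq_gaussQuantile : ConvexOn ℝ (Ioo 0 1) fun p => gaussQuantile p ^ 2 := by
  have hd : ∀ p ∈ Ioo (0 : ℝ) 1, deriv (fun q => gaussQuantile q ^ 2) p =
      2 * gaussQuantile p / gaussProfile p := fun p hp => (hasDerivAt_sq_gaussQuantile hp).deriv
  refine MonotoneOn.convexOn_of_deriv (convex_Ioo 0 1)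
    (fun p hp => (hasDerivAt_sq_gaussQuantile hp).continuousAt.continuousWithinAt) ?_ ?_
  · rw [interior_Ioo]
    exact fun p hp => (hasDerivAt_sq_gaussQuantile hp).differentiableAt.differentiableWithinAt
  · rw [interior_Ioo]
    intro p hp q hq hpq
    rw [hd p hp, hd q hq]
    exact monotoneOn_deriv_sq_gaussQuantile hp hq hpq

lemma one_sub_gaussCDF_le {r : ℝ} (hr : 0 ≤ r) : 1 - gaussCDF r ≤ exp (-r ^ 2 / 2) := by
  have h1 : 1 - gaussCDF r = (gaussianReal 0 1).real (Ici r) := by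
    rw [← gaussCDF_neg, gaussianReal_real_eq_setIntegral, integral_Ici_eq_integral_Ioi,
      gaussCDF, ← integral_comp_neg_Ioi]
    simp [gaussDensity_neg]
  rw [h1]
  have h2 := measure_ge_le_exp_mul_mgf (μ := gaussianReal 0 1) (X := id) r (t := r) hr
    (integrable_exp_mul_gaussianReal r)
  refine h2.trans (le_of_eq ?_)
  rw [mgf_id_gaussianReal, ← Real.exp_add]
  simp only [NNReal.coe_one]
  congr 1
  ring

lemma nonneg_of_hasDerivAt_nonneg {g g' : ℝ → ℝ} {x : ℝ} (hx : 0 ≤ x) (h0 : g 0 = 0)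
    (hd : ∀ y ∈ Icc 0 x, HasDerivAt g (g' y) y) (hg : ∀ y ∈ Icc 0 x, 0 ≤ g' y) : 0 ≤ g x := by
  have hm : MonotoneOn g (Icc 0 x) := by
    refine monotoneOn_of_deriv_nonneg (convex_Icc 0 x)
      (fun y hy => (hd y hy).continuousAt.continuousWithinAt) ?_ ?_
    · exact fun y hy => (hd y (interior_subset hy)).differentiableAt.differentiableWithinAt
    · intro y hy
      rw [(hd y (interior_subset hy)).deriv]
      exact hg y (interior_subset hy)
  rw [← h0]
  exact hm ⟨le_rfl, hx⟩ ⟨hx, le_rfl⟩ hx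

lemma hasDerivAt_sq_gaussProfile {p : ℝ} (hp : p ∈ Ioo (0 : ℝ) 1) :
    HasDerivAt (fun q => gaussProfile q ^ 2) (-2 * (gaussProfile p * gaussQuantile p)) p :=
  ((hasDerivAt_gaussProfile hp).fun_pow 2).congr_deriv (by simp; ring)

lemma hasDerivAt_gaussProfile_mul_gaussQuantile {p : ℝ} (hp : p ∈ Ioo (0 : ℝ) 1) :
    HasDerivAt (fun q => gaussProfile q * gaussQuantile q) (1 - gaussQuantile p ^ 2) p := by
  refine ((hasDerivAt_gaussProfile hp).fun_mul (hasDerivAt_gaussQuantile hp)).congr_deriv ?_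
  have := (gaussProfile_pos p).ne'
  rw [← gaussProfile, mul_inv_cancel₀ this]
  ring

lemma HasDerivAt.comp_add_sub {F : ℝ → ℝ} {a b c y : ℝ} (h1 : HasDerivAt F a (c + y))
    (h2 : HasDerivAt F b (c - y)) :
    HasDerivAt (fun y => F (c + y)) a y ∧ HasDerivAt (fun y => F (c - y)) (-b) y :=
  ⟨h1.comp_const_add c y, h2.comp_const_sub c y⟩

section TwoPoint

variable {c x : ℝ}

lemma sq_gaussQuantile_add_le_sub (h0 : 0 < c - x) (hx : 0 ≤ x) (hc : c ≤ 1 / 2) :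
    gaussQuantile (c + x) ^ 2 ≤ gaussQuantile (c - x) ^ 2 := by
  have m1 : c - x ∈ Ioo (0 : ℝ) 1 := ⟨h0, by linarith⟩
  have m2 : c + x ∈ Ioo (0 : ℝ) 1 := ⟨by linarith, by linarith⟩
  have m3 : 1 - (c - x) ∈ Ioo (0 : ℝ) 1 := ⟨by linarith, by linarith⟩
  have e1 := strictMonoOn_gaussQuantile.monotoneOn m1 m2 (by linarith)
  have e2 := strictMonoOn_gaussQuantile.monotoneOn m2 m3 (by linarith)
  rw [gaussQuantile_one_sub m1] at e2
  nlinarith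

lemma two_mul_sq_gaussQuantile_mul_sq_le (h0 : 0 < c - x) (h1 : c + x < 1) (hx : 0 ≤ x) :
    2 * gaussQuantile c ^ 2 * x ^ 2 ≤
      gaussProfile (c + x) ^ 2 + gaussProfile (c - x) ^ 2 - 2 * gaussProfile c ^ 2 + 2 * x ^ 2 := by
  have mp : ∀ y ∈ Icc 0 x, c + y ∈ Ioo (0 : ℝ) 1 := fun y hy =>
    ⟨by linarith [hy.1], by linarith [hy.2]⟩
  have mm : ∀ y ∈ Icc 0 x, c - y ∈ Ioo (0 : ℝ) 1 := fun y hy =>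
    ⟨by linarith [hy.2], by linarith [hy.1]⟩
  have hd2 : ∀ y ∈ Icc 0 x, 0 ≤ -2 * (gaussProfile (c + y) * gaussQuantile (c + y)) +
      2 * (gaussProfile (c - y) * gaussQuantile (c - y)) + 4 * y - 4 * gaussQuantile c ^ 2 * y := by
    intro y hy
    have hsub : ∀ u ∈ Icc 0 y, u ∈ Icc 0 x := fun u hu => ⟨hu.1, hu.2.trans hy.2⟩
    refine nonneg_of_hasDerivAt_nonneg (g := fun y =>
      -2 * (gaussProfile (c + y) * gaussQuantile (c + y)) +
      2 * (gaussProfile (c - y) * gaussQuantile (c - y)) + 4 * y - 4 * gaussQuantile c ^ 2 * y)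
      (g' := fun y => -2 * (1 - gaussQuantile (c + y) ^ 2) +
        2 * -(1 - gaussQuantile (c - y) ^ 2) + 4 * 1 - 4 * gaussQuantile c ^ 2 * 1) hy.1
      (by simp) ?_ ?_
    · intro u hu
      obtain ⟨a, b⟩ := HasDerivAt.comp_add_sub
        (hasDerivAt_gaussProfile_mul_gaussQuantile (mp u (hsub u hu)))
        (hasDerivAt_gaussProfile_mul_gaussQuantile (mm u (hsub u hu)))
      exact (((a.const_mul (-2)).add (b.const_mul 2)).add
        ((hasDerivAt_id u).const_mul 4)).sub ((hasDerivAt_id u).const_mul _)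
    · intro u hu
      have := convexOn_sq_gaussQuantile.2 (mp u (hsub u hu)) (mm u (hsub u hu))
        (by norm_num : (0 : ℝ) ≤ 1 / 2) (by norm_num : (0 : ℝ) ≤ 1 / 2) (by norm_num)
      simp only [smul_eq_mul] at this
      rw [show 1 / 2 * (c + u) + 1 / 2 * (c - u) = c by ring] at this
      linarith
  have := nonneg_of_hasDerivAt_nonneg (g := fun y =>
      gaussProfile (c + y) ^ 2 + gaussProfile (c - y) ^ 2 - 2 * gaussProfile c ^ 2 + 2 * y ^ 2 -
        2 * gaussQuantile c ^ 2 * y ^ 2)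
      (g' := fun y => -2 * (gaussProfile (c + y) * gaussQuantile (c + y)) +
      2 * (gaussProfile (c - y) * gaussQuantile (c - y)) + 4 * y - 4 * gaussQuantile c ^ 2 * y)
      hx (by simp; ring) ?_ hd2
  · linarith
  · intro u hu
    obtain ⟨a, b⟩ := HasDerivAt.comp_add_sub
        (hasDerivAt_sq_gaussProfile (mp u hu)) (hasDerivAt_sq_gaussProfile (mm u hu))
    exact ((((a.add b).sub_const _).add (((hasDerivAt_id u).fun_pow 2).const_mul 2)).sub
        (((hasDerivAt_id u).fun_pow 2).const_mul (2 * gaussQuantile c ^ 2))).congr_deriv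
        (by simp; ring)

lemma sq_gaussProfile_sub_sq_le (h0 : 0 < c - x) (hx : 0 ≤ x) (hc : c ≤ 1 / 2) :
    gaussProfile (c + x) ^ 2 - gaussProfile (c - x) ^ 2 ≤
      -4 * (gaussProfile c * gaussQuantile c) * x := by
  have mp : ∀ y ∈ Icc 0 x, c + y ∈ Ioo (0 : ℝ) 1 := fun y hy =>
    ⟨by linarith [hy.1], by linarith [hy.2]⟩
  have mm : ∀ y ∈ Icc 0 x, c - y ∈ Ioo (0 : ℝ) 1 := fun y hy =>
    ⟨by linarith [hy.2], by linarith [hy.1]⟩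
  have hd2 : ∀ y ∈ Icc 0 x, 0 ≤ -4 * (gaussProfile c * gaussQuantile c) +
      2 * (gaussProfile (c + y) * gaussQuantile (c + y)) +
      2 * (gaussProfile (c - y) * gaussQuantile (c - y)) := by
    intro y hy
    have hsub : ∀ u ∈ Icc 0 y, u ∈ Icc 0 x := fun u hu => ⟨hu.1, hu.2.trans hy.2⟩
    refine nonneg_of_hasDerivAt_nonneg (g := fun y =>
      -4 * (gaussProfile c * gaussQuantile c) +
      2 * (gaussProfile (c + y) * gaussQuantile (c + y)) +
      2 * (gaussProfile (c - y) * gaussQuantile (c - y)))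
      (g' := fun y => 2 * (1 - gaussQuantile (c + y) ^ 2) +
        2 * -(1 - gaussQuantile (c - y) ^ 2)) hy.1
      (by simp; ring) ?_ ?_
    · intro u hu
      obtain ⟨a, b⟩ := HasDerivAt.comp_add_sub
        (hasDerivAt_gaussProfile_mul_gaussQuantile (mp u (hsub u hu)))
        (hasDerivAt_gaussProfile_mul_gaussQuantile (mm u (hsub u hu)))
      exact ((a.const_mul 2).const_add _).add (b.const_mul 2)
    · intro u hu
      have := sq_gaussQuantile_add_le_sub (mm u (hsub u hu)).1 hu.1 hc
      linarith
  have := nonneg_of_hasDerivAt_nonneg (g := fun y =>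
      -4 * (gaussProfile c * gaussQuantile c) * y -
        (gaussProfile (c + y) ^ 2 - gaussProfile (c - y) ^ 2))
      (g' := fun y => -4 * (gaussProfile c * gaussQuantile c) +
      2 * (gaussProfile (c + y) * gaussQuantile (c + y)) +
      2 * (gaussProfile (c - y) * gaussQuantile (c - y)))
      hx (by simp) ?_ hd2
  · linarith
  · intro u hu
    obtain ⟨a, b⟩ := HasDerivAt.comp_add_sub
        (hasDerivAt_sq_gaussProfile (mp u hu)) (hasDerivAt_sq_gaussProfile (mm u hu))
    exact (((hasDerivAt_id u).const_mul _).sub (a.sub b)).congr_deriv (by ring)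

lemma sq_gaussProfile_sub_nonneg (h0 : 0 < c - x) (hx : 0 ≤ x) (hc : c ≤ 1 / 2) :
    0 ≤ gaussProfile (c + x) ^ 2 - gaussProfile (c - x) ^ 2 := by
  have h := sq_gaussQuantile_add_le_sub h0 hx hc
  have : gaussProfile (c - x) ≤ gaussProfile (c + x) := by
    unfold gaussProfile gaussDensity
    gcongr
  have := gaussProfile_pos (c - x)
  nlinarith

lemma two_mul_le_sqrt_add_sqrt {A B P : ℝ} (hA : 0 ≤ A) (hB : 0 ≤ B)
    (h : (A - B) ^ 2 ≤ 8 * P ^ 2 * (A + B - 2 * P ^ 2)) : 2 * P ≤ √A + √B := by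
  obtain ⟨a, ha, rfl⟩ : ∃ a, 0 ≤ a ∧ A = a ^ 2 := ⟨√A, sqrt_nonneg _, (sq_sqrt hA).symm⟩
  obtain ⟨b, hb, rfl⟩ : ∃ b, 0 ≤ b ∧ B = b ^ 2 := ⟨√B, sqrt_nonneg _, (sq_sqrt hB).symm⟩
  rw [sqrt_sq ha, sqrt_sq hb]
  by_contra! hlt
  have h1 : 0 < 4 * P ^ 2 - (a + b) ^ 2 := by nlinarith
  have h2 : 0 < 4 * P ^ 2 - (a - b) ^ 2 := by nlinarith [mul_nonneg ha hb]
  nlinarith [mul_pos h1 h2]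

lemma two_mul_gaussProfile_le_of_le_half (h0 : 0 < c - x) (hx : 0 ≤ x) (hc : c ≤ 1 / 2) :
    2 * gaussProfile c ≤
      √(gaussProfile (c + x) ^ 2 + x ^ 2) + √(gaussProfile (c - x) ^ 2 + x ^ 2) := by
  refine two_mul_le_sqrt_add_sqrt (by positivity) (by positivity) ?_
  have e1 := two_mul_sq_gaussQuantile_mul_sq_le h0 (by linarith) hx
  have e2 := sq_gaussProfile_sub_sq_le h0 hx hc
  have e3 := sq_gaussProfile_sub_nonneg h0 hx hc
  have e4 := mul_le_mul_of_nonneg_left e1 (by positivity : 0 ≤ 8 * gaussProfile c ^ 2)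
  have e5 := pow_le_pow_left₀ e3 e2 2
  nlinarith

end TwoPoint

/-- **Bobkov's two-point inequality**. -/
theorem gaussProfile_midpoint_le {a b : ℝ} (ha : a ∈ Ioo (0 : ℝ) 1) (hb : b ∈ Ioo (0 : ℝ) 1) :
    gaussProfile (1 / 2 * (a + b)) ≤
      1 / 2 * (√(gaussProfile a ^ 2 + (1 / 2 * (a - b)) ^ 2) +
        √(gaussProfile b ^ 2 + (1 / 2 * (a - b)) ^ 2)) := by
  wlog hab : b ≤ a generalizing a b
  · have := this hb ha (le_of_not_ge hab)
    rw [add_comm a b, show (1 / 2 * (a - b)) ^ 2 = (1 / 2 * (b - a)) ^ 2 by ring]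
    linarith
  wlog hc : 1 / 2 * (a + b) ≤ 1 / 2 generalizing a b
  · have := this (a := 1 - b) (b := 1 - a) ⟨by linarith [hb.2], by linarith [hb.1]⟩
      ⟨by linarith [ha.2], by linarith [ha.1]⟩ (by linarith) (by linarith)
    rw [gaussProfile_one_sub ha, gaussProfile_one_sub hb,
      show 1 / 2 * (1 - b + (1 - a)) = 1 - 1 / 2 * (a + b) by ring, gaussProfile_one_sub,
      show 1 / 2 * (1 - b - (1 - a)) = 1 / 2 * (a - b) by ring] at this
    · linarith
    · constructor <;> linarith [ha.1, ha.2, hb.1, hb.2]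
  have := two_mul_gaussProfile_le_of_le_half (c := 1 / 2 * (a + b)) (x := 1 / 2 * (a - b))
    (by linarith [hb.1]) (by linarith) hc
  rw [show 1 / 2 * (a + b) + 1 / 2 * (a - b) = a by ring,
    show 1 / 2 * (a + b) - 1 / 2 * (a - b) = b by ring] at this
  linarith

section Walk

variable {E : Type*} [AddCommGroup E]

/-- The average of `f` over the points `x ± v₁ ± ⋯ ± vₖ`, where `v₁, …, vₖ` are the entries
of the list. -/
noncomputable def signAverage : List E → (E → ℝ) → E → ℝ
  | [], f, x => f x
  | v :: l, f, x => 1 / 2 * (signAverage l f (x + v) + signAverage l f (x - v))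

lemma signAverage_mono {f g : E → ℝ} (h : ∀ x, f x ≤ g x) (l : List E) (x : E) :
    signAverage l f x ≤ signAverage l g x := by
  induction l generalizing x with
  | nil => exact h x
  | cons v l ih => simp only [signAverage]; linarith [ih (x + v), ih (x - v)]

lemma signAverage_const (c : ℝ) (l : List E) (x : E) : signAverage l (fun _ => c) x = c := by
  induction l generalizing x with
  | nil => rfl
  | cons v l ih => simp only [signAverage, ih]; ring

lemma signAverage_add (f g : E → ℝ) (l : List E) (x : E) :
    signAverage l (fun y => f y + g y) x = signAverage l f x + signAverage l g x := by
  induction l generalizing x with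
  | nil => rfl
  | cons v l ih => simp only [signAverage, ih]; ring

lemma signAverage_const_mul (c : ℝ) (f : E → ℝ) (l : List E) (x : E) :
    signAverage l (fun y => c * f y) x = c * signAverage l f x := by
  induction l generalizing x with
  | nil => rfl
  | cons v l ih => simp only [signAverage, ih]; ring

lemma signAverage_comp_add (f : E → ℝ) (w : E) (l : List E) (x : E) :
    signAverage l (fun y => f (y + w)) x = signAverage l f (x + w) := by
  induction l generalizing x with
  | nil => rfl
  | cons v l ih =>
    simp only [signAverage, ih]
    rw [add_right_comm, sub_add_eq_add_sub]

lemma signAverage_mem_Ioo {f : E → ℝ} (h : ∀ x, f x ∈ Ioo (0 : ℝ) 1) (l : List E) (x : E) :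
    signAverage l f x ∈ Ioo (0 : ℝ) 1 := by
  induction l generalizing x with
  | nil => exact h x
  | cons v l ih =>
    have h1 := ih (x + v)
    have h2 := ih (x - v)
    constructor <;> simp only [signAverage] <;> linarith [h1.1, h1.2, h2.1, h2.2]

lemma sqrt_add_sq_add_add_sq_le (p q r s : ℝ) :
    √((p + q) ^ 2 + (r + s) ^ 2) ≤ √(p ^ 2 + r ^ 2) + √(q ^ 2 + s ^ 2) := by
  rw [sqrt_le_left (by positivity), add_sq (√_), sq_sqrt (by positivity), sq_sqrt (by positivity)]
  have : p * q + r * s ≤ √(p ^ 2 + r ^ 2) * √(q ^ 2 + s ^ 2) := by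
    rw [← sqrt_mul (by positivity)]
    refine le_sqrt_of_sq_le ?_
    nlinarith [sq_nonneg (p * s - q * r)]
  linarith

lemma sqrt_sq_signAverage_add_sq_le (a b : E → ℝ) (l : List E) (x : E) :
    √(signAverage l a x ^ 2 + signAverage l b x ^ 2) ≤
      signAverage l (fun y => √(a y ^ 2 + b y ^ 2)) x := by
  induction l generalizing x with
  | nil => exact le_rfl
  | cons v l ih =>
    simp only [signAverage]
    have h := sqrt_add_sq_add_add_sq_le (signAverage l a (x + v)) (signAverage l a (x - v))
      (signAverage l b (x + v)) (signAverage l b (x - v))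
    rw [mul_pow, mul_pow, ← mul_add, sqrt_mul (by positivity), sqrt_sq (by norm_num)]
    linarith [ih (x + v), ih (x - v)]

lemma abs_signAverage_le (f : E → ℝ) (l : List E) (x : E) :
    |signAverage l f x| ≤ signAverage l (fun y => |f y|) x := by
  induction l generalizing x with
  | nil => exact le_rfl
  | cons v l ih =>
    simp only [signAverage]
    rw [abs_mul, abs_of_pos (by norm_num : (0 : ℝ) < 1 / 2)]
    have := abs_add_le (signAverage l f (x + v)) (signAverage l f (x - v))
    linarith [ih (x + v), ih (x - v)]

lemma abs_signAverage_sub_le {f g : E → ℝ} {w : E} (h : ∀ y, 1 / 2 * |f y - f (y + w)| ≤ g y)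
    (l : List E) (x : E) :
    |1 / 2 * (signAverage l f x - signAverage l f (x + w))| ≤ signAverage l g x := by
  rw [← signAverage_comp_add, abs_mul, abs_of_pos (by norm_num : (0 : ℝ) < 1 / 2)]
  have h1 : signAverage l f x - signAverage l (fun y => f (y + w)) x =
      signAverage l (fun y => f y + -1 * f (y + w)) x := by
    rw [signAverage_add, signAverage_const_mul]; ring
  rw [h1]
  calc _ ≤ 1 / 2 * signAverage l (fun y => |f y + -1 * f (y + w)|) x := by
        gcongr; exact abs_signAverage_le _ _ _
    _ = signAverage l (fun y => 1 / 2 * |f y + -1 * f (y + w)|) x :=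
        (signAverage_const_mul _ _ _ _).symm
    _ ≤ _ := signAverage_mono (fun y => by
        have := h y
        rwa [show f y + -1 * f (y + w) = f y - f (y + w) by ring]) _ _

/-- **Bobkov's inequality** for sums of independent random signs. -/
theorem gaussProfile_signAverage_le {f : E → ℝ} (hf : ∀ x, f x ∈ Ioo (0 : ℝ) 1)
    (g : E → E → ℝ) (l : List E)
    (h1 : ∀ v ∈ l, ∀ y, 1 / 2 * |f y - f (y + 2 • v)| ≤ g v y)
    (h2 : ∀ v ∈ l, ∀ y, 1 / 2 * |f y - f (y + -(2 • v))| ≤ g v y) (x : E) :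
    gaussProfile (signAverage l f x) ≤
      signAverage l (fun y => √(gaussProfile (f y) ^ 2 + (l.map fun v => g v y ^ 2).sum)) x := by
  induction l generalizing x with
  | nil => simp [signAverage, sqrt_sq (gaussProfile_pos _).le]
  | cons v l ih =>
    have ih := ih (fun u hu => h1 u (List.mem_cons_of_mem _ hu))
      (fun u hu => h2 u (List.mem_cons_of_mem _ hu))
    have h1 := h1 v List.mem_cons_self
    have h2 := h2 v List.mem_cons_self
    have key : ∀ D y, |D| ≤ signAverage l (g v) y →
        √(gaussProfile (signAverage l f y) ^ 2 + D ^ 2) ≤ signAverage l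
          (fun y => √(gaussProfile (f y) ^ 2 + ((v :: l).map fun v => g v y ^ 2).sum)) y := by
      intro D y hD
      calc _ ≤ √((signAverage l
            (fun y => √(gaussProfile (f y) ^ 2 + (l.map fun v => g v y ^ 2).sum)) y) ^ 2 +
            (signAverage l (g v) y) ^ 2) := by
            refine sqrt_le_sqrt (add_le_add
              (pow_le_pow_left₀ (gaussProfile_pos _).le (ih y) 2) ?_)
            rw [← sq_abs]
            exact pow_le_pow_left₀ (abs_nonneg _) hD 2
        _ ≤ _ := sqrt_sq_signAverage_add_sq_le _ _ _ _
        _ ≤ _ := by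
            refine signAverage_mono (fun z => le_of_eq ?_) _ _
            rw [sq_sqrt, List.map_cons, List.sum_cons]
            · congr 1; ring
            · have : 0 ≤ (l.map fun v => g v z ^ 2).sum :=
                List.sum_nonneg (by simp; intros; positivity)
              positivity
    have b := gaussProfile_midpoint_le (signAverage_mem_Ioo hf l (x + v))
      (signAverage_mem_Ioo hf l (x - v))
    have k1 := key (1 / 2 * (signAverage l f (x + v) - signAverage l f (x - v))) (x + v) (by
      have := abs_signAverage_sub_le h2 l (x + v)
      rwa [show x + v + -(2 • v) = x - v by abel] at this)
    have k2 := key (1 / 2 * (signAverage l f (x + v) - signAverage l f (x - v))) (x - v) (by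
      have := abs_signAverage_sub_le h1 l (x - v)
      rw [show x - v + 2 • v = x + v by abel] at this
      rwa [← abs_neg, ← mul_neg, neg_sub])
    simp only [signAverage]
    linarith

end Walk

section SignMeasure

open scoped RealInnerProductSpace

variable {E : Type*} [NormedAddCommGroup E] [MeasurableSpace E] [BorelSpace E]

/-- The law of `± v₁ ± ⋯ ± vₖ` with independent uniform signs, where `v₁, …, vₖ` are the entries
of the list. -/
noncomputable def signMeasure : List E → Measure E
  | [] => Measure.dirac 0
  | v :: l => (2⁻¹ : ℝ≥0∞) • (signMeasure l).map (fun y => y + v) +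
      (2⁻¹ : ℝ≥0∞) • (signMeasure l).map (fun y => y + -v)

instance isProbabilityMeasure_signMeasure (l : List E) :
    IsProbabilityMeasure (signMeasure l) := by
  induction l with
  | nil => exact Measure.dirac.isProbabilityMeasure
  | cons v l ih =>
    constructor
    simp only [signMeasure, Measure.coe_add, Measure.coe_smul, Pi.add_apply, Pi.smul_apply,
      smul_eq_mul]
    rw [Measure.map_apply (by fun_prop) MeasurableSet.univ,
      Measure.map_apply (by fun_prop) MeasurableSet.univ]
    simp [ENNReal.inv_two_add_inv_two]

lemma integrable_signMeasure {F : Type*} [NormedAddCommGroup F] [SecondCountableTopology F]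
    [MeasurableSpace F] [BorelSpace F] {f : E → F} (hf : Continuous f) (l : List E) :
    Integrable f (signMeasure l) := by
  induction l generalizing f with
  | nil => exact integrable_dirac (by simp)
  | cons v l ih =>
    have h : ∀ w : E, Integrable f ((signMeasure l).map fun y => y + w) := fun w =>
      (integrable_map_measure hf.aestronglyMeasurable (by fun_prop)).2
        (ih (f := f ∘ fun y => y + w) (by fun_prop))
    exact ((h v).smul_measure (by simp)).add_measure ((h (-v)).smul_measure (by simp))

lemma integral_signMeasure_cons {F : Type*} [NormedAddCommGroup F] [SecondCountableTopology F]
    [NormedSpace ℝ F] [MeasurableSpace F] [BorelSpace F]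
    {f : E → F} (hf : Continuous f) (v : E) (l : List E) :
    ∫ y, f y ∂signMeasure (v :: l) = (1 / 2 : ℝ) • ((∫ y, f (y + v) ∂signMeasure l) +
      ∫ y, f (y + -v) ∂signMeasure l) := by
  have h : ∀ w : E, Integrable f ((signMeasure l).map fun y => y + w) := fun w =>
    (integrable_map_measure hf.aestronglyMeasurable (by fun_prop)).2
      (integrable_signMeasure (f := f ∘ fun y => y + w) (by fun_prop) l)
  rw [signMeasure, integral_add_measure ((h v).smul_measure (by simp))
    ((h (-v)).smul_measure (by simp)), MeasureTheory.integral_smul_measure,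
    MeasureTheory.integral_smul_measure,
    integral_map (by fun_prop) hf.aestronglyMeasurable,
    integral_map (by fun_prop) hf.aestronglyMeasurable, smul_add]
  simp

lemma signAverage_eq_integral {f : E → ℝ} (hf : Continuous f) (l : List E) (x : E) :
    signAverage l f x = ∫ y, f (x + y) ∂signMeasure l := by
  induction l generalizing x with
  | nil => simp [signAverage, signMeasure]
  | cons v l ih =>
    rw [integral_signMeasure_cons (by fun_prop), signAverage, ih, ih, smul_eq_mul]
    congr 3 <;> ext y <;> congr 1 <;> abel

variable [InnerProductSpace ℝ E]

lemma charFun_signMeasure (l : List E) (t : E) :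
    charFun (signMeasure l) t = (l.map fun v => ((Real.cos ⟪v, t⟫ : ℝ) : ℂ)).prod := by
  induction l with
  | nil => simp [signMeasure]
  | cons v l ih =>
    rw [List.map_cons, List.prod_cons, ← ih, charFun_apply, integral_signMeasure_cons (by fun_prop),
      charFun_apply, ← integral_const_mul, ← integral_add, ← integral_smul]
    · congr 1 with y
      rw [inner_add_left, inner_add_left, inner_neg_left]
      push_cast
      rw [Complex.cos, add_mul, add_mul, Complex.exp_add, Complex.exp_add, Complex.real_smul]
      push_cast
      ring
    · exact integrable_signMeasure (by fun_prop) l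
    · exact integrable_signMeasure (by fun_prop) l

lemma tendsto_cos_pow (t : ℝ) :
    Filter.Tendsto (fun n : ℕ => ((Real.cos ((√n)⁻¹ * t) : ℝ) : ℂ) ^ n) Filter.atTop
      (nhds (Complex.exp (-t ^ 2 / 2))) := by
  have h := tendsto_charFun_inv_sqrt_mul_pow (P := signMeasure [(1 : ℝ)]) (X := id)
    aemeasurable_id ?_ ?_ t
  · simpa [charFun_signMeasure] using h
  · rw [integral_signMeasure_cons (by fun_prop)]
    simp [signMeasure]
  · rw [show (id ^ 2 : ℝ → ℝ) = fun x => x ^ 2 from rfl, integral_signMeasure_cons (by fun_prop)]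
    simp [signMeasure]
    norm_num

variable [FiniteDimensional ℝ E]

/-- The steps of a rescaled random walk: `N` copies of each `eᵢ / √N`, where `(eᵢ)` is an
orthonormal basis. -/
noncomputable def walkSteps (E : Type*) [NormedAddCommGroup E] [InnerProductSpace ℝ E]
    [FiniteDimensional ℝ E] (N : ℕ) : List E :=
  (List.finRange (Module.finrank ℝ E)).flatMap fun i =>
    List.replicate N ((√N)⁻¹ • stdOrthonormalBasis ℝ E i)

lemma tendsto_charFun_walkSteps (t : E) :
    Filter.Tendsto (fun N => charFun (signMeasure (walkSteps E N)) t) Filter.atTop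
      (nhds (charFun (ProbabilityTheory.stdGaussian E) t)) := by
  have h : ∀ N, charFun (signMeasure (walkSteps E N)) t =
      ∏ i, ((Real.cos ((√N)⁻¹ * ⟪stdOrthonormalBasis ℝ E i, t⟫) : ℝ) : ℂ) ^ N := by
    intro N
    rw [charFun_signMeasure, walkSteps, List.map_flatMap, List.flatMap_def, List.prod_flatten,
      ← List.prod_ofFn, List.ofFn_eq_map, List.map_map]
    congr 1
    refine List.map_congr_left fun i _ => ?_
    rw [Function.comp_apply, List.map_replicate, List.prod_replicate, real_inner_smul_left]
  simp_rw [h]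
  rw [charFun_stdGaussian, ← Complex.ofReal_pow, ← (stdOrthonormalBasis ℝ E).sum_sq_inner_right t]
  convert tendsto_finsetProd Finset.univ fun i _ => tendsto_cos_pow ⟪stdOrthonormalBasis ℝ E i, t⟫
  rw [← Complex.exp_sum]
  push_cast
  rw [← Finset.sum_div, Finset.sum_neg_distrib]

lemma tendsto_signAverage_walkSteps {f : E → ℝ} (hf : Continuous f) {C : ℝ}
    (hC : ∀ x, |f x| ≤ C) :
    Filter.Tendsto (fun N => signAverage (walkSteps E N) f 0) Filter.atTop
      (nhds (∫ y, f y ∂ProbabilityTheory.stdGaussian E)) := by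
  have h := (ProbabilityMeasure.tendsto_iff_tendsto_charFun
    (μ := fun N => ⟨signMeasure (walkSteps E N), inferInstance⟩)
    (μ₀ := ⟨ProbabilityTheory.stdGaussian E, inferInstance⟩)).2 tendsto_charFun_walkSteps
  have h2 := ProbabilityMeasure.tendsto_iff_forall_integral_tendsto.1 h
    (BoundedContinuousFunction.ofNormedAddCommGroup f hf C hC)
  simp_rw [signAverage_eq_integral hf, zero_add]
  exact h2

end SignMeasure

lemma sum_map_walkSteps {E : Type*} [NormedAddCommGroup E] [InnerProductSpace ℝ E]
    [FiniteDimensional ℝ E] (F : E → ℝ) (N : ℕ) :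
    ((walkSteps E N).map F).sum =
      ∑ i, N * F ((√N)⁻¹ • stdOrthonormalBasis ℝ E i) := by
  rw [walkSteps, List.map_flatMap, List.flatMap_def, List.sum_flatten,
    ← List.sum_ofFn, List.ofFn_eq_map, List.map_map]
  congr 1
  refine List.map_congr_left fun i _ => ?_
  rw [Function.comp_apply, List.map_replicate, List.sum_replicate, nsmul_eq_mul]

lemma gaussDensity_le_one (x : ℝ) : gaussDensity x ≤ 1 := by
  unfold gaussDensity
  have h1 : (√(2 * π))⁻¹ ≤ 1 := by
    refine inv_le_one_of_one_le₀ (one_le_sqrt.2 ?_)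
    linarith [Real.pi_gt_three]
  have h2 : exp (-x ^ 2 / 2) ≤ 1 := exp_le_one_iff.2 (by nlinarith [sq_nonneg x])
  have := exp_pos (-x ^ 2 / 2)
  exact mul_le_one₀ h1 this.le h2

lemma abs_gaussCDF_le_one (x : ℝ) : |gaussCDF x| ≤ 1 := by
  rw [abs_of_pos (gaussCDF_mem x).1]; exact (gaussCDF_mem x).2.le

lemma abs_gaussDensity_le_one (x : ℝ) : |gaussDensity x| ≤ 1 := by
  rw [abs_of_pos (gaussDensity_pos x)]; exact gaussDensity_le_one x

section Integral

variable {E : Type*} [TopologicalSpace E] [MeasurableSpace E] [OpensMeasurableSpace E]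

lemma integrable_gaussCDF_comp (μ : Measure E) [IsFiniteMeasure μ] {v : E → ℝ}
    (hv : Continuous v) : Integrable (fun y => gaussCDF (v y)) μ :=
  Integrable.of_bound (continuous_gaussCDF.comp hv).aestronglyMeasurable 1
    (Filter.Eventually.of_forall fun y => abs_gaussCDF_le_one (v y))

lemma integral_gaussCDF_mem (μ : Measure E) [IsProbabilityMeasure μ] {v : E → ℝ}
    (hv : Continuous v) : ∫ y, gaussCDF (v y) ∂μ ∈ Ioo (0 : ℝ) 1 := by
  have hsupp : ∀ f : E → ℝ, (∀ x, 0 < f x) → Integrable f μ → 0 < ∫ x, f x ∂μ := by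
    intro f hf hi
    rw [integral_pos_iff_support_of_nonneg (fun x => (hf x).le) hi]
    rw [Function.support_eq_univ fun x => (hf x).ne']
    simp
  have hi := integrable_gaussCDF_comp μ hv
  refine ⟨hsupp _ (fun x => (gaussCDF_mem _).1) hi, ?_⟩
  have := hsupp (fun y => 1 - gaussCDF (v y)) (fun x => by linarith [(gaussCDF_mem (v x)).2])
    ((integrable_const 1).sub hi)
  rw [integral_sub (integrable_const 1) hi] at this
  simp at this
  linarith

end Integral

section GaussianBobkov

open scoped RealInnerProductSpace

variable {E : Type*} [NormedAddCommGroup E] [InnerProductSpace ℝ E]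

lemma half_abs_sub_le {f : E → ℝ} {G : E → E} {C : ℝ}
    (hG : ∀ y w, |f (y + w) - f y - ⟪G y, w⟫| ≤ C * ‖w‖ ^ 2) (y v : E) :
    1 / 2 * |f y - f (y + 2 • v)| ≤ |⟪G y, v⟫| + 2 * C * ‖v‖ ^ 2 := by
  have h := hG y (2 • v)
  rw [two_nsmul, inner_add_right, ← two_nsmul, ← Nat.cast_smul_eq_nsmul ℝ, norm_smul, mul_pow] at h
  simp only [Nat.cast_ofNat, Real.norm_ofNat] at h
  rw [← Nat.cast_smul_eq_nsmul ℝ]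
  simp only [Nat.cast_ofNat]
  have h3 : |f y - f (y + (2 : ℝ) • v)| ≤ 2 * |⟪G y, v⟫| +
      |f (y + (2 : ℝ) • v) - f y - (⟪G y, v⟫ + ⟪G y, v⟫)| := by
    calc |f y - f (y + (2 : ℝ) • v)| = |-(f (y + (2 : ℝ) • v) - f y - (⟪G y, v⟫ + ⟪G y, v⟫)) -
          2 * ⟪G y, v⟫| := by congr 1; ring
      _ ≤ |-(f (y + (2 : ℝ) • v) - f y - (⟪G y, v⟫ + ⟪G y, v⟫))| + |2 * ⟪G y, v⟫| := abs_sub _ _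
      _ = _ := by rw [abs_neg, abs_mul, abs_two]; ring
  linarith

variable [FiniteDimensional ℝ E]

lemma gaussProfile_signAverage_walkSteps_le {v : E → ℝ} {G : E → E} {C m : ℝ} (hm : 0 ≤ m)
    (hC : 0 ≤ C)
    (hG : ∀ y w, |gaussCDF (v (y + w)) - gaussCDF (v y) - ⟪G y, w⟫| ≤ C * ‖w‖ ^ 2)
    (hGm : ∀ y, ‖G y‖ ≤ m * gaussDensity (v y)) {N : ℕ} (hN : 0 < N) :
    gaussProfile (signAverage (walkSteps E N) (fun y => gaussCDF (v y)) 0) ≤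
      √(1 + m ^ 2) * signAverage (walkSteps E N) (fun y => gaussDensity (v y)) 0 +
      √(Module.finrank ℝ E * (4 * C * m * (√N)⁻¹ + 4 * C ^ 2 * ((√N)⁻¹) ^ 2)) := by
  set h : ℝ := (√N)⁻¹ with hh
  have hh0 : 0 ≤ h := by positivity
  have hN' : (N : ℝ) * h ^ 2 = 1 := by
    rw [hh, inv_pow, sq_sqrt (by positivity)]
    field_simp
  set g : E → E → ℝ := fun v y => |⟪G y, v⟫| + 2 * C * ‖v‖ ^ 2
  have hsum : ∀ y, ((walkSteps E N).map fun w => g w y ^ 2).sum ≤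
      (m * gaussDensity (v y)) ^ 2 +
        Module.finrank ℝ E * (4 * C * m * h + 4 * C ^ 2 * h ^ 2) := by
    intro y
    rw [sum_map_walkSteps (fun w => g w y ^ 2)]
    have hterm : ∀ i, N * g (h • stdOrthonormalBasis ℝ E i) y ^ 2 ≤
        ⟪G y, stdOrthonormalBasis ℝ E i⟫ ^ 2 + (4 * C * m * h + 4 * C ^ 2 * h ^ 2) := by
      intro i
      have hb : ‖stdOrthonormalBasis ℝ E i‖ = 1 := (stdOrthonormalBasis ℝ E).norm_eq_one i
      have hp : |⟪G y, stdOrthonormalBasis ℝ E i⟫| ≤ m := by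
        refine (abs_real_inner_le_norm _ _).trans ?_
        rw [hb, mul_one]
        exact (hGm y).trans (mul_le_of_le_one_right hm (gaussDensity_le_one _))
      simp only [g, inner_smul_right, norm_smul, hb, mul_one, abs_mul, Real.norm_eq_abs,
        abs_of_nonneg hh0]
      set p := |⟪G y, stdOrthonormalBasis ℝ E i⟫|
      rw [← sq_abs (⟪G y, stdOrthonormalBasis ℝ E i⟫)]
      calc N * (h * p + 2 * C * h ^ 2) ^ 2 = (N * h ^ 2) * (p + 2 * C * h) ^ 2 := by ring
        _ = p ^ 2 + (4 * C * p * h + 4 * C ^ 2 * h ^ 2) := by rw [hN']; ring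
        _ ≤ _ := by gcongr
    refine (Finset.sum_le_sum fun i _ => hterm i).trans ?_
    rw [Finset.sum_add_distrib, Finset.sum_const, nsmul_eq_mul, Finset.card_univ,
      Fintype.card_fin]
    have hs : ∑ i, ⟪G y, stdOrthonormalBasis ℝ E i⟫ ^ 2 = ‖G y‖ ^ 2 :=
      (stdOrthonormalBasis ℝ E).sum_sq_inner_left (G y)
    rw [hs]
    gcongr
    exact hGm y
  have hbob := gaussProfile_signAverage_le (f := fun y => gaussCDF (v y))
      (fun x => gaussCDF_mem _) g (walkSteps E N)
      (fun w _ y => half_abs_sub_le (f := fun y => gaussCDF (v y)) hG y w)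
    (fun w _ y => by
      have := half_abs_sub_le (f := fun y => gaussCDF (v y)) hG y (-w)
      rwa [inner_neg_right, abs_neg, norm_neg, smul_neg] at this) 0
  refine hbob.trans ?_
  rw [← signAverage_const_mul, ← signAverage_const
    (√(Module.finrank ℝ E * (4 * C * m * h + 4 * C ^ 2 * h ^ 2))) (walkSteps E N) (0 : E),
    ← signAverage_add]
  refine signAverage_mono (fun y => ?_) _ _
  have hφ := (gaussDensity_pos (v y)).le
  have e1 : gaussProfile (gaussCDF (v y)) = gaussDensity (v y) := by
    rw [gaussProfile, gaussQuantile_gaussCDF]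
  calc _ ≤ √((√(1 + m ^ 2) * gaussDensity (v y)) ^ 2 +
        Module.finrank ℝ E * (4 * C * m * h + 4 * C ^ 2 * h ^ 2)) := by
        refine sqrt_le_sqrt ?_
        rw [e1, mul_pow, sq_sqrt (by positivity)]
        linarith [hsum y]
    _ ≤ √((√(1 + m ^ 2) * gaussDensity (v y)) ^ 2) + _ := by
        have hnn : 0 ≤ Module.finrank ℝ E * (4 * C * m * h + 4 * C ^ 2 * h ^ 2) := by positivity
        have := sqrt_add_sq_add_add_sq_le (√(1 + m ^ 2) * gaussDensity (v y)) 0 0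
          √(Module.finrank ℝ E * (4 * C * m * h + 4 * C ^ 2 * h ^ 2))
        simpa only [add_zero, zero_add, ne_eq, OfNat.ofNat_ne_zero, not_false_eq_true, zero_pow,
          sq_sqrt hnn] using this
    _ = _ := by rw [sqrt_sq (by positivity)]

variable [MeasurableSpace E] [BorelSpace E]

/-- **Bobkov's functional isoperimetric inequality**, for functions of the form `Φ ∘ v`. -/
theorem gaussProfile_integral_gaussCDF_le {v : E → ℝ} (hv : Continuous v) {G : E → E} {C m : ℝ}
    (hm : 0 ≤ m) (hC : 0 ≤ C)
    (hG : ∀ y w, |gaussCDF (v (y + w)) - gaussCDF (v y) - ⟪G y, w⟫| ≤ C * ‖w‖ ^ 2)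
    (hGm : ∀ y, ‖G y‖ ≤ m * gaussDensity (v y)) :
    gaussProfile (∫ y, gaussCDF (v y) ∂ProbabilityTheory.stdGaussian E) ≤
      √(1 + m ^ 2) * ∫ y, gaussDensity (v y) ∂ProbabilityTheory.stdGaussian E := by
  have h1 := tendsto_signAverage_walkSteps (E := E) (f := fun y => gaussCDF (v y))
    (continuous_gaussCDF.comp hv) (C := 1) fun x => abs_gaussCDF_le_one _
  have h2 := tendsto_signAverage_walkSteps (E := E) (f := fun y => gaussDensity (v y))
    (continuous_gaussDensity.comp hv) (C := 1) fun x => abs_gaussDensity_le_one _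
  have h3 : Filter.Tendsto (fun N : ℕ => (√(N : ℝ))⁻¹) Filter.atTop (nhds 0) :=
    (tendsto_sqrt_atTop.comp tendsto_natCast_atTop_atTop).inv_tendsto_atTop
  have h4 : Filter.Tendsto (fun N : ℕ =>
      √(Module.finrank ℝ E * (4 * C * m * (√N)⁻¹ + 4 * C ^ 2 * ((√N)⁻¹) ^ 2)))
      Filter.atTop (nhds 0) := by
    have hc : Continuous fun x : ℝ =>
        √(Module.finrank ℝ E * (4 * C * m * x + 4 * C ^ 2 * x ^ 2)) := by fun_prop
    have := (hc.tendsto 0).comp h3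
    rw [show √(Module.finrank ℝ E * (4 * C * m * 0 + 4 * C ^ 2 * (0 : ℝ) ^ 2)) = 0 by simp] at this
    exact this
  have h5 := ((hasDerivAt_gaussProfile (integral_gaussCDF_mem
    (ProbabilityTheory.stdGaussian E) hv)).continuousAt.tendsto).comp h1
  have h6 := (h2.const_mul √(1 + m ^ 2)).add h4
  rw [add_zero] at h6
  refine le_of_tendsto_of_tendsto h5 h6 ?_
  filter_upwards [Filter.eventually_gt_atTop 0] with N hN
  exact gaussProfile_signAverage_walkSteps_le hm hC hG hGm hN

end GaussianBobkov

lemma abs_mul_gaussDensity_le_one (x : ℝ) : |-x * gaussDensity x| ≤ 1 := by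
  have h1 : gaussDensity x ≤ exp (-(x ^ 2 / 2)) := by
    unfold gaussDensity
    rw [neg_div]
    refine mul_le_of_le_one_left (exp_pos _).le (inv_le_one_of_one_le₀ (one_le_sqrt.2 ?_))
    linarith [Real.pi_gt_three]
  have h2 : |x| ≤ exp (x ^ 2 / 2) := by
    have := add_one_le_exp (x ^ 2 / 2)
    have h3 := sq_nonneg (|x| - 1)
    have h4 := sq_abs x
    nlinarith
  rw [abs_mul, abs_neg, abs_of_pos (gaussDensity_pos x)]
  calc |x| * gaussDensity x ≤ exp (x ^ 2 / 2) * exp (-(x ^ 2 / 2)) :=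
        mul_le_mul h2 h1 (gaussDensity_pos x).le (exp_pos _).le
    _ = 1 := by rw [← Real.exp_add]; simp

lemma abs_gaussDensity_sub_le (x y : ℝ) : |gaussDensity y - gaussDensity x| ≤ |y - x| := by
  have := Convex.norm_image_sub_le_of_norm_hasDerivWithin_le (f := gaussDensity)
    (f' := fun x => -x * gaussDensity x) (C := 1) (s := univ) (x := x) (y := y)
    (fun x _ => (hasDerivAt_gaussDensity x).hasDerivWithinAt)
    (fun x _ => abs_mul_gaussDensity_le_one x) convex_univ (mem_univ _) (mem_univ _)
  simpa using this

lemma abs_gaussCDF_add_sub_le (a b : ℝ) :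
    |gaussCDF (a + b) - gaussCDF a - gaussDensity a * b| ≤ b ^ 2 := by
  have := Convex.norm_image_sub_le_of_norm_hasDerivWithin_le
    (f := fun t => gaussCDF (a + t) - gaussDensity a * t)
    (f' := fun t => gaussDensity (a + t) - gaussDensity a) (C := |b|) (s := uIcc 0 b)
    (x := 0) (y := b)
    (fun t _ => (((hasDerivAt_gaussCDF (a + t)).comp_const_add a t).sub
      (((hasDerivAt_id t).const_mul (gaussDensity a)).congr_deriv (mul_one _))).hasDerivWithinAt)
    (fun t ht => by
      have h1 := abs_gaussDensity_sub_le a (a + t)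
      have h2 := abs_sub_left_of_mem_uIcc ht
      rw [add_sub_cancel_left] at h1
      rw [sub_zero, sub_zero] at h2
      exact h1.trans h2) (convex_uIcc _ _)
    left_mem_uIcc right_mem_uIcc
  simp only [add_zero, mul_zero, sub_zero, Real.norm_eq_abs] at this
  rw [abs_mul_abs_self, ← sq] at this
  rwa [show gaussCDF (a + b) - gaussCDF a - gaussDensity a * b =
    gaussCDF (a + b) - gaussDensity a * b - gaussCDF a by ring]

/-- A smooth approximation of the distance to a convex set. -/
noncomputable def smoothDist {E : Type*} [PseudoMetricSpace E] (K : Set E) (η : ℝ) (y : E) : ℝ :=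
  √(Metric.infDist y K ^ 2 + η ^ 2)

lemma continuous_smoothDist {E : Type*} [PseudoMetricSpace E] (K : Set E) (η : ℝ) :
    Continuous (smoothDist K η) := by
  unfold smoothDist
  have := Metric.continuous_infDist_pt K
  fun_prop

section ConvexDistance

open scoped RealInnerProductSpace

variable {E : Type*} [NormedAddCommGroup E] [InnerProductSpace ℝ E] [FiniteDimensional ℝ E]

lemma exists_sq_infDist_add_bounds {K : Set E} (hK : IsClosed K) (hc : Convex ℝ K)
    (hne : K.Nonempty) (y : E) :
    ∃ q : E, ‖q‖ = Metric.infDist y K ∧ ∀ w,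
      2 * ⟪q, w⟫ ≤ Metric.infDist (y + w) K ^ 2 - Metric.infDist y K ^ 2 ∧
      Metric.infDist (y + w) K ^ 2 - Metric.infDist y K ^ 2 ≤ 2 * ⟪q, w⟫ + ‖w‖ ^ 2 := by
  have : ProperSpace E := FiniteDimensional.proper ℝ E
  obtain ⟨p, hpK, hp⟩ := hK.exists_infDist_eq_dist hne y
  have hmin : ∀ k ∈ K, ⟪y - p, k - p⟫ ≤ 0 := by
    rw [← norm_eq_iInf_iff_real_inner_le_zero hc hpK, ← dist_eq_norm, ← hp,
      Metric.infDist_eq_iInf]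
    simp [dist_eq_norm]
  refine ⟨y - p, by rw [hp, dist_eq_norm], fun w => ⟨?_, ?_⟩⟩
  · obtain ⟨k, hkK, hk⟩ := hK.exists_infDist_eq_dist hne (y + w)
    rw [hk, hp, dist_eq_norm, dist_eq_norm,
      show y + w - k = (y - p) + (w - (k - p)) by abel, norm_add_sq_real, inner_sub_right]
    nlinarith [hmin k hkK, sq_nonneg ‖w - (k - p)‖]
  · have h1 : Metric.infDist (y + w) K ^ 2 ≤ ‖(y - p) + w‖ ^ 2 := by
      refine pow_le_pow_left₀ Metric.infDist_nonneg ?_ 2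
      rw [show y - p + w = y + w - p by abel, ← dist_eq_norm]
      exact Metric.infDist_le_dist_of_mem hpK
    rw [norm_add_sq_real] at h1
    rw [hp, dist_eq_norm]
    linarith

lemma abs_sqrt_sq_add_sub_le (a b η : ℝ) :
    |√(a ^ 2 + η ^ 2) - √(b ^ 2 + η ^ 2)| ≤ |a - b| := by
  have h1 := sqrt_add_sq_add_add_sq_le b (a - b) η 0
  have h2 := sqrt_add_sq_add_add_sq_le a (b - a) η 0
  simp only [add_sub_cancel, add_zero, ne_eq, OfNat.ofNat_ne_zero, not_false_eq_true, zero_pow,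
    sqrt_sq_eq_abs] at h1 h2
  rw [abs_sub_comm b a] at h2
  rw [abs_le]
  constructor <;> linarith

lemma exists_abs_smoothDist_add_sub_le {K : Set E} (hK : IsClosed K) (hc : Convex ℝ K)
    (hne : K.Nonempty) {η : ℝ} (hη : 0 < η) (y : E) :
    ∃ q : E, ‖q‖ ≤ 1 ∧ ∀ w, |smoothDist K η (y + w) - smoothDist K η y| ≤ ‖w‖ ∧
      |smoothDist K η (y + w) - smoothDist K η y - ⟪q, w⟫| ≤ ‖w‖ ^ 2 / (2 * η) := by
  obtain ⟨q, hq, hw⟩ := exists_sq_infDist_add_bounds hK hc hne y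
  set u := smoothDist K η y with hu
  have hu2 : ∀ z, smoothDist K η z ^ 2 = Metric.infDist z K ^ 2 + η ^ 2 := fun z =>
    sq_sqrt (by positivity)
  have huη : η ≤ u := le_sqrt_of_sq_le (by nlinarith [sq_nonneg (Metric.infDist y K)])
  have hu0 : 0 < u := hη.trans_le huη
  refine ⟨u⁻¹ • q, ?_, fun w => ?_⟩
  · rw [norm_smul, norm_inv, Real.norm_of_nonneg hu0.le, inv_mul_le_one₀ hu0, hq]
    exact le_sqrt_of_sq_le (by nlinarith [sq_nonneg η])
  · have hlip : |smoothDist K η (y + w) - u| ≤ ‖w‖ := by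
      refine (abs_sqrt_sq_add_sub_le _ _ _).trans ?_
      have h := (Metric.lipschitz_infDist_pt K).dist_le_mul (y + w) y
      simpa [Real.dist_eq] using h
    refine ⟨hlip, ?_⟩
    obtain ⟨h1, h2⟩ := hw w
    set Δ := smoothDist K η (y + w) - u with hΔ
    have hsq : Δ ^ 2 ≤ ‖w‖ ^ 2 := sq_le_sq.2 (by rwa [abs_norm])
    have he : 2 * u * Δ + Δ ^ 2 = Metric.infDist (y + w) K ^ 2 - Metric.infDist y K ^ 2 := by
      have e1 := hu2 (y + w)
      have e2 := hu2 y
      rw [← hu] at e2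
      rw [show smoothDist K η (y + w) = u + Δ by rw [hΔ]; ring] at e1
      linarith
    rw [real_inner_smul_left]
    have hkey : |2 * u * (Δ - u⁻¹ * ⟪q, w⟫)| ≤ ‖w‖ ^ 2 := by
      rw [mul_sub, show 2 * u * (u⁻¹ * ⟪q, w⟫) = 2 * ⟪q, w⟫ by field_simp, abs_le]
      constructor <;> nlinarith [sq_nonneg Δ]
    rw [abs_mul, abs_of_pos (by positivity)] at hkey
    rw [le_div_iff₀ (by positivity), mul_comm]
    exact (mul_le_mul_of_nonneg_right (by linarith) (abs_nonneg _)).trans hkey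

end ConvexDistance

lemma infDist_le_smoothDist {E : Type*} [PseudoMetricSpace E] (K : Set E) (η : ℝ) (y : E) :
    Metric.infDist y K ≤ smoothDist K η y :=
  le_sqrt_of_sq_le (by nlinarith [sq_nonneg η])

lemma smoothDist_of_mem {E : Type*} [PseudoMetricSpace E] {K : Set E} {η : ℝ} (hη : 0 ≤ η) {y : E}
    (hy : y ∈ K) : smoothDist K η y = η := by
  simp [smoothDist, Metric.infDist_zero_of_mem hy, sqrt_sq hη]

lemma continuous_sub_smoothDist_div {E : Type*} [PseudoMetricSpace E] (K : Set E) (η ε s : ℝ) :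
    Continuous fun y => (s - smoothDist K η y) / ε := by
  have := continuous_smoothDist K η
  fun_prop

section Isoperimetry

open scoped RealInnerProductSpace

variable {E : Type*} [NormedAddCommGroup E] [InnerProductSpace ℝ E] [FiniteDimensional ℝ E]
  [MeasurableSpace E] [BorelSpace E]

/-- The Gaussian expectation of a smooth approximation of the indicator function of the
`s`-neighbourhood of `K`. -/
noncomputable def smoothEnlargement (K : Set E) (η ε s : ℝ) : ℝ :=
  ∫ y, gaussCDF ((s - smoothDist K η y) / ε) ∂ProbabilityTheory.stdGaussian E

lemma smoothEnlargement_mem (K : Set E) (η ε s : ℝ) :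
    smoothEnlargement K η ε s ∈ Ioo (0 : ℝ) 1 :=
  integral_gaussCDF_mem _ (continuous_sub_smoothDist_div K η ε s)

lemma hasDerivAt_smoothEnlargement (K : Set E) (η : ℝ) {ε : ℝ} (hε : 0 < ε) (s : ℝ) :
    HasDerivAt (smoothEnlargement K η ε)
      (∫ y, gaussDensity ((s - smoothDist K η y) / ε) * (1 / ε)
        ∂ProbabilityTheory.stdGaussian E) s := by
  have hc := continuous_sub_smoothDist_div K η ε
  refine (hasDerivAt_integral_of_dominated_loc_of_deriv_le (s := univ)
    (F := fun s y => gaussCDF ((s - smoothDist K η y) / ε))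
    (F' := fun s y => gaussDensity ((s - smoothDist K η y) / ε) * (1 / ε))
    (bound := fun _ => 1 / ε) Filter.univ_mem ?_ ?_ ?_ ?_ (integrable_const _) ?_).2
  · exact Filter.Eventually.of_forall fun s =>
      (continuous_gaussCDF.comp (hc s)).aestronglyMeasurable
  · exact integrable_gaussCDF_comp _ (hc s)
  · exact ((continuous_gaussDensity.comp (hc s)).mul continuous_const).aestronglyMeasurable
  · refine Filter.Eventually.of_forall fun y s _ => ?_
    rw [norm_mul, Real.norm_eq_abs, Real.norm_of_nonneg (by positivity)]
    exact mul_le_of_le_one_left (by positivity) (abs_gaussDensity_le_one _)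
  · refine Filter.Eventually.of_forall fun y s _ => ?_
    exact (hasDerivAt_gaussCDF _).comp s (((hasDerivAt_id s).sub_const _).div_const ε)

lemma gaussProfile_smoothEnlargement_le {K : Set E} (hK : IsClosed K) (hc : Convex ℝ K)
    (hne : K.Nonempty) {η ε : ℝ} (hη : 0 < η) (hε : 0 < ε) (s : ℝ) :
    gaussProfile (smoothEnlargement K η ε s) ≤ (1 + ε) *
      ∫ y, gaussDensity ((s - smoothDist K η y) / ε) * (1 / ε)
        ∂ProbabilityTheory.stdGaussian E := by
  choose q hq1 hq using exists_abs_smoothDist_add_sub_le hK hc hne hη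
  set v : E → ℝ := fun y => (s - smoothDist K η y) / ε with hv
  have key := gaussProfile_integral_gaussCDF_le (E := E) (v := v)
    (continuous_sub_smoothDist_div K η ε s) (G := fun y => -(gaussDensity (v y) / ε) • q y)
    (C := 1 / ε ^ 2 + 1 / (2 * η * ε)) (m := 1 / ε) (by positivity) (by positivity) ?_ ?_
  · refine key.trans ?_
    rw [integral_mul_const, mul_comm _ (1 / ε), ← mul_assoc]
    refine mul_le_mul_of_nonneg_right ?_ (integral_nonneg fun y => (gaussDensity_pos _).le)
    rw [sqrt_le_left (by positivity)]
    have : (1 + ε) * (1 / ε) = 1 + 1 / ε := by field_simp; ring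
    rw [this]
    have : 0 < 1 / ε := by positivity
    nlinarith
  · intro y w
    obtain ⟨h1, h2⟩ := hq y w
    set Δ := smoothDist K η (y + w) - smoothDist K η y
    have hvw : v (y + w) = v y + -(Δ / ε) := by simp only [hv, Δ]; ring
    have hφ := gaussDensity_le_one (v y)
    have hφ0 := gaussDensity_pos (v y)
    rw [hvw, real_inner_smul_left]
    have e1 := abs_gaussCDF_add_sub_le (v y) (-(Δ / ε))
    have e2 : |gaussDensity (v y) * (-(Δ / ε)) - -(gaussDensity (v y) / ε) * ⟪q y, w⟫| ≤
        ‖w‖ ^ 2 / (2 * η * ε) := by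
      rw [show gaussDensity (v y) * (-(Δ / ε)) - -(gaussDensity (v y) / ε) * ⟪q y, w⟫ =
        -(gaussDensity (v y) * ((Δ - ⟪q y, w⟫) / ε)) by ring, abs_neg, abs_mul,
        abs_of_pos hφ0, abs_div, abs_of_pos hε]
      refine (mul_le_of_le_one_left (by positivity) hφ).trans ?_
      rw [← div_div]
      gcongr
    have e3 : (-(Δ / ε)) ^ 2 ≤ ‖w‖ ^ 2 / ε ^ 2 := by
      rw [neg_sq, div_pow]
      gcongr ?_ / _
      exact sq_le_sq.2 (by rwa [abs_norm])
    calc _ = |(gaussCDF (v y + -(Δ / ε)) - gaussCDF (v y) - gaussDensity (v y) * -(Δ / ε)) +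
          (gaussDensity (v y) * (-(Δ / ε)) - -(gaussDensity (v y) / ε) * ⟪q y, w⟫)| := by
          congr 1; ring
      _ ≤ _ := abs_add_le _ _
      _ ≤ ‖w‖ ^ 2 / ε ^ 2 + ‖w‖ ^ 2 / (2 * η * ε) := add_le_add (e1.trans e3) e2
      _ = _ := by ring
  · intro y
    have hφ0 := gaussDensity_pos (v y)
    rw [norm_smul, norm_neg, Real.norm_of_nonneg (by positivity)]
    refine (mul_le_of_le_one_right (by positivity) (hq1 y)).trans (le_of_eq (by ring))

lemma sub_le_gaussQuantile_smoothEnlargement_sub {K : Set E} (hK : IsClosed K) (hc : Convex ℝ K)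
    (hne : K.Nonempty) {η ε : ℝ} (hη : 0 < η) (hε : 0 < ε) {s s' : ℝ} (hs : s ≤ s') :
    (s' - s) / (1 + ε) ≤ gaussQuantile (smoothEnlargement K η ε s') -
      gaussQuantile (smoothEnlargement K η ε s) := by
  set H' : ℝ → ℝ := fun s => ∫ y, gaussDensity ((s - smoothDist K η y) / ε) * (1 / ε)
        ∂ProbabilityTheory.stdGaussian E
  have hm : Monotone fun s => gaussQuantile (smoothEnlargement K η ε s) - s / (1 + ε) := by
    refine monotone_of_hasDerivAt_nonneg
      (f' := fun s => (gaussProfile (smoothEnlargement K η ε s))⁻¹ * H' s - 1 / (1 + ε)) ?_ ?_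
    · intro s
      exact ((hasDerivAt_gaussQuantile (smoothEnlargement_mem K η ε s)).comp s
        (hasDerivAt_smoothEnlargement K η hε s)).sub ((hasDerivAt_id s).div_const _)
    · intro s
      have h := gaussProfile_smoothEnlargement_le hK hc hne hη hε s
      have hp := gaussProfile_pos (smoothEnlargement K η ε s)
      simp only [Pi.zero_apply]
      rw [sub_nonneg, inv_mul_eq_div, div_le_div_iff₀ (by positivity) hp]
      linarith
  have := hm hs
  simp only at this
  rw [sub_div]
  linarith

lemma mul_le_smoothEnlargement {K : Set E} (hK : MeasurableSet K) {η ε : ℝ} (hη : 0 ≤ η) (s : ℝ) :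
    (ProbabilityTheory.stdGaussian E).real K * gaussCDF ((s - η) / ε) ≤
      smoothEnlargement K η ε s := by
  rw [← smul_eq_mul, ← integral_indicator_const _ hK]
  refine integral_mono ((integrable_const _).indicator hK)
    (integrable_gaussCDF_comp _ (continuous_sub_smoothDist_div K η ε s)) fun y => ?_
  by_cases hy : y ∈ K
  · rw [indicator_of_mem hy, smoothDist_of_mem hη hy]
  · rw [indicator_of_notMem hy]; exact (gaussCDF_mem _).1.le

lemma smoothEnlargement_le (K : Set E) (η : ℝ) {ε : ℝ} (hε : 0 < ε) (s r : ℝ) :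
    smoothEnlargement K η ε s ≤
      1 - (ProbabilityTheory.stdGaussian E).real {y | r ≤ Metric.infDist y K} +
        gaussCDF ((s - r) / ε) := by
  have hA : MeasurableSet {y | r ≤ Metric.infDist y K} :=
    (isClosed_le continuous_const (Metric.continuous_infDist_pt K)).measurableSet
  rw [← probReal_compl_eq_one_sub hA]
  have h1 : ∀ y, gaussCDF ((s - smoothDist K η y) / ε) ≤
      {y | r ≤ Metric.infDist y K}ᶜ.indicator (fun _ => (1 : ℝ)) y + gaussCDF ((s - r) / ε) := by
    intro y
    by_cases hy : r ≤ Metric.infDist y K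
    · rw [indicator_of_notMem (by simpa using hy), zero_add]
      refine strictMono_gaussCDF.monotone ?_
      have := infDist_le_smoothDist K η y
      gcongr
      linarith
    · rw [indicator_of_mem (by simpa using hy)]
      linarith [(gaussCDF_mem ((s - smoothDist K η y) / ε)).2, (gaussCDF_mem ((s - r) / ε)).1]
  have hi : Integrable ({y | r ≤ Metric.infDist y K}ᶜ.indicator (fun _ => (1 : ℝ)))
    (ProbabilityTheory.stdGaussian E) := (integrable_const _).indicator hA.compl
  refine (integral_mono (integrable_gaussCDF_comp _ (continuous_sub_smoothDist_div K η ε s))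
    (hi.add (integrable_const _)) h1).trans (le_of_eq ?_)
  simp only [Pi.add_apply]
  rw [integral_add hi (integrable_const _), integral_indicator_const _ hA.compl]
  simp

/-- **Gaussian isoperimetric inequality** for the neighbourhoods of a convex set of measure at
least `1 / 2`. -/
theorem stdGaussian_real_le_infDist_le {K : Set E} (hK : IsClosed K) (hc : Convex ℝ K)
    (hhalf : 1 / 2 ≤ (ProbabilityTheory.stdGaussian E).real K) {r : ℝ} (hr : 0 < r) :
    (ProbabilityTheory.stdGaussian E).real {y | r ≤ Metric.infDist y K} ≤ 1 - gaussCDF r := by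
  have hne : K.Nonempty := by
    by_contra h
    rw [not_nonempty_iff_eq_empty] at h
    simp [h] at hhalf
    linarith
  set A := {y : E | r ≤ Metric.infDist y K}
  have hbound : ∀ᶠ ρ in nhdsWithin (0 : ℝ) (Ioi 0),
      gaussCDF (gaussQuantile (1 / 2 * gaussCDF (1 / 2 * ρ⁻¹)) + (r - 2 * ρ) / (1 + ρ ^ 2)) ≤
        1 - (ProbabilityTheory.stdGaussian E).real A + gaussCDF (-ρ⁻¹) := by
    filter_upwards [Ioo_mem_nhdsGT (show (0 : ℝ) < r / 2 by linarith)] with ρ hρ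
    have hρ0 : 0 < ρ := hρ.1
    have h1 := mul_le_smoothEnlargement (E := E) hK.measurableSet (η := ρ / 2) (ε := ρ ^ 2)
      (by positivity) ρ
    have h2 := sub_le_gaussQuantile_smoothEnlargement_sub hK hc hne (η := ρ / 2) (ε := ρ ^ 2)
      (by positivity) (by positivity) (s := ρ) (s' := r - ρ) (by linarith [hρ.2])
    have h3 := smoothEnlargement_le K (ρ / 2) (ε := ρ ^ 2) (by positivity) (r - ρ) r
    rw [show (ρ - ρ / 2) / ρ ^ 2 = 1 / 2 * ρ⁻¹ by field_simp; norm_num] at h1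
    rw [show (r - ρ - r) / ρ ^ 2 = -ρ⁻¹ by field_simp; ring] at h3
    have hΦ := gaussCDF_mem (1 / 2 * ρ⁻¹)
    have h4 : gaussQuantile (1 / 2 * gaussCDF (1 / 2 * ρ⁻¹)) ≤
        gaussQuantile (smoothEnlargement K (ρ / 2) (ρ ^ 2) ρ) := by
      refine strictMonoOn_gaussQuantile.monotoneOn ⟨by linarith [hΦ.1], by linarith [hΦ.2]⟩
        (smoothEnlargement_mem _ _ _ _) ?_
      exact (mul_le_mul_of_nonneg_right hhalf hΦ.1.le).trans h1
    refine le_trans ?_ h3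
    rw [← gaussCDF_gaussQuantile (smoothEnlargement_mem K (ρ / 2) (ρ ^ 2) (r - ρ))]
    refine strictMono_gaussCDF.monotone ?_
    rw [show r - ρ - ρ = r - 2 * ρ by ring] at h2
    linarith
  have hinv : Filter.Tendsto (fun ρ : ℝ => ρ⁻¹) (nhdsWithin 0 (Ioi 0)) Filter.atTop :=
    tendsto_inv_nhdsGT_zero
  have hlim1 : Filter.Tendsto (fun ρ : ℝ => gaussCDF (-ρ⁻¹)) (nhdsWithin 0 (Ioi 0)) (nhds 0) :=
    tendsto_gaussCDF_atBot.comp (Filter.tendsto_neg_atTop_atBot.comp hinv)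
  have hlim2 : Filter.Tendsto (fun ρ : ℝ => 1 / 2 * gaussCDF (1 / 2 * ρ⁻¹))
      (nhdsWithin 0 (Ioi 0)) (nhds (1 / 2)) := by
    have := (tendsto_gaussCDF_atTop.comp (hinv.const_mul_atTop
      (by norm_num : (0 : ℝ) < 1 / 2))).const_mul (1 / 2)
    rwa [mul_one] at this
  have hlim3 := (hasDerivAt_gaussQuantile (p := 1 / 2) (by norm_num)).continuousAt.tendsto.comp
    hlim2
  rw [gaussQuantile_half] at hlim3
  have hlim4 : Filter.Tendsto (fun ρ : ℝ => (r - 2 * ρ) / (1 + ρ ^ 2)) (nhdsWithin 0 (Ioi 0))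
      (nhds r) := by
    have hcont : Continuous fun ρ : ℝ => (r - 2 * ρ) / (1 + ρ ^ 2) := by
      refine Continuous.div (by fun_prop) (by fun_prop) fun x => by positivity
    have := (hcont.tendsto 0).mono_left (nhdsWithin_le_nhds (s := Ioi 0))
    simpa using this
  have hlim5 := (continuous_gaussCDF.tendsto _).comp (hlim3.add hlim4)
  rw [zero_add] at hlim5
  have := le_of_tendsto_of_tendsto hlim5 (hlim1.const_add _) hbound
  linarith

end Isoperimetry

lemma gaussCDF_mul_sub_half_le {s x : ℝ} (hs : 1 ≤ s) (hx : 0 ≤ x) :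
    gaussCDF (s * x) - 1 / 2 ≤ s * (gaussCDF x - 1 / 2) := by
  have := nonneg_of_hasDerivAt_nonneg
    (g := fun x => s * (gaussCDF x - 1 / 2) - (gaussCDF (s * x) - 1 / 2))
    (g' := fun x => s * gaussDensity x - gaussDensity (s * x) * (s * 1)) hx
    (by simp [gaussCDF_zero]) ?_ ?_
  · linarith
  · intro y _
    exact (((hasDerivAt_gaussCDF y).sub_const _).const_mul s).sub
      (((hasDerivAt_gaussCDF (s * y)).comp y ((hasDerivAt_id y).const_mul s)).sub_const _)
  · intro y hy
    have h : gaussDensity (s * y) ≤ gaussDensity y := by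
      unfold gaussDensity
      have : y ≤ s * y := le_mul_of_one_le_left hy.1 hs
      have := hy.1
      gcongr
    nlinarith

lemma integral_gaussianReal_eq (f : ℝ → ℝ) :
    ∫ x, f x ∂gaussianReal 0 1 = ∫ x, gaussDensity x * f x := by
  rw [integral_gaussianReal_eq_integral_smul (by simp), gaussDensity_eq_gaussianPDFReal]
  simp

lemma integrable_gaussDensity_mul {f : ℝ → ℝ} (hf : Integrable f (gaussianReal 0 1)) :
    Integrable fun x => gaussDensity x * f x := by
  rw [gaussianReal_of_var_ne_zero _ (by simp)] at hf
  have h := (integrable_withDensity_iff_integrable_smul' (measurable_gaussianPDF 0 1)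
    (Filter.Eventually.of_forall fun x => gaussianPDF_lt_top)).1 hf
  refine h.congr (Filter.Eventually.of_forall fun x => ?_)
  simp [toReal_gaussianPDF, gaussDensity_eq_gaussianPDFReal]

/-- A sharpening of Jensen's inequality for nonnegative convex functions of a Gaussian variable. -/
lemma two_mul_mul_one_sub_gaussCDF_le_integral {σ : ℝ → ℝ} (hc : ConvexOn ℝ univ σ)
    (h0 : ∀ x, 0 ≤ σ x) (hi : Integrable σ (gaussianReal 0 1)) {T : ℝ} (hT : 0 ≤ T) :
    2 * σ T * (1 - gaussCDF T) ≤ ∫ x, σ x ∂gaussianReal 0 1 := by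
  rw [integral_gaussianReal_eq]
  set F : ℝ → ℝ := fun x => gaussDensity x * σ x with hF
  have hFi : Integrable F := integrable_gaussDensity_mul hi
  have hF0 : ∀ x, 0 ≤ F x := fun x => mul_nonneg (gaussDensity_pos x).le (h0 x)
  have hsplit : ∫ x, F x = (∫ x, (Iic T).indicator F (2 * T - x)) + ∫ x, (Ioi T).indicator F x := by
    rw [integral_sub_left_eq_self (fun x => (Iic T).indicator F x) volume (2 * T),
      integral_indicator measurableSet_Iic, integral_indicator measurableSet_Ioi,
      intervalIntegral.integral_Iic_add_Ioi hFi.integrableOn hFi.integrableOn]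
  have htail : 2 * σ T * (1 - gaussCDF T) =
      ∫ x, (Ioi T).indicator (fun x => 2 * σ T * gaussDensity x) x := by
    rw [integral_indicator measurableSet_Ioi, integral_const_mul]
    have h2 := intervalIntegral.integral_Iic_add_Ioi (b := T)
      integrable_gaussDensity.integrableOn integrable_gaussDensity.integrableOn
    rw [integral_gaussDensity] at h2
    rw [gaussCDF, ← h2]
    ring
  have hi1 : Integrable fun x => (Iic T).indicator F (2 * T - x) :=
    (hFi.indicator measurableSet_Iic).comp_sub_left (2 * T)
  have hi2 : Integrable fun x => (Ioi T).indicator F x := hFi.indicator measurableSet_Ioi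
  rw [hsplit, htail, ← integral_add hi1 hi2]
  refine integral_mono ((integrable_gaussDensity.const_mul _).indicator measurableSet_Ioi)
    (hi1.add hi2) fun x => ?_
  by_cases hx : x ∈ Ioi T
  · have hx' : T < x := hx
    have hm : 2 * T - x ∈ Iic T := by simp only [mem_Iic]; linarith
    simp only [indicator_of_mem hx, indicator_of_mem hm, hF]
    have h1 : gaussDensity x ≤ gaussDensity (2 * T - x) := by
      unfold gaussDensity
      have : (2 * T - x) ^ 2 ≤ x ^ 2 := by nlinarith
      gcongr
    have h2 : 2 * σ T ≤ σ (2 * T - x) + σ x := by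
      have := hc.2 (mem_univ (2 * T - x)) (mem_univ x)
        (by norm_num : (0 : ℝ) ≤ 1 / 2) (by norm_num : (0 : ℝ) ≤ 1 / 2) (by norm_num)
      simp only [smul_eq_mul] at this
      rw [show 1 / 2 * (2 * T - x) + 1 / 2 * x = T by ring] at this
      linarith
    nlinarith [mul_le_mul_of_nonneg_right h1 (h0 (2 * T - x)), gaussDensity_pos x]
  · simp only [indicator_of_notMem hx, add_zero]
    exact indicator_nonneg (fun y _ => hF0 y) _

/-- A lower bound for the median of `dτ + σ(τ)`, where `τ` is a standard Gaussian variable and `σ`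
is convex and increasing. -/
lemma half_add_le_gaussianReal_real {σ : ℝ → ℝ} (hc : ConvexOn ℝ univ σ) (hm : Monotone σ)
    (h0 : ∀ x, 0 ≤ σ x) (hi : Integrable σ (gaussianReal 0 1)) {d : ℝ} (hd : 0 < d) :
    1 / 2 + (2 * gaussCDF (1 / (2 * d)) - 1) * (1 / 2 - ∫ x, σ x ∂gaussianReal 0 1) ≤
      (gaussianReal 0 1).real {τ | d * τ + σ τ ≤ 1} := by
  have hbase : ∀ T, d * T + σ T ≤ 1 →
      gaussCDF T ≤ (gaussianReal 0 1).real {τ | d * τ + σ τ ≤ 1} := by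
    intro T hT
    rw [gaussCDF_eq_real]
    refine measureReal_mono fun τ (hτ : τ ≤ T) => ?_
    have := hm hτ
    simp only [Set.mem_ofPred_eq]
    nlinarith
  set m := ∫ x, σ x ∂gaussianReal 0 1
  have hm0 : 0 ≤ m := integral_nonneg h0
  set κ := 2 * gaussCDF (1 / (2 * d)) - 1 with hκ
  have hκ0 : 0 ≤ κ := by
    have : gaussCDF 0 ≤ gaussCDF (1 / (2 * d)) := strictMono_gaussCDF.monotone (by positivity)
    rw [gaussCDF_zero] at this
    linarith
  have hκ1 : κ ≤ 1 := by linarith [(gaussCDF_mem (1 / (2 * d))).2]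
  rcases le_or_gt 1 (σ 0) with hw | hw
  · obtain ⟨v, hv⟩ : ∃ v, v = σ 0 - 1 := ⟨_, rfl⟩
    have hv0 : 0 ≤ v := by linarith
    refine le_trans ?_ (hbase (-(v / d)) ?_)
    · have hmw := two_mul_mul_one_sub_gaussCDF_le_integral hc h0 hi le_rfl
      rw [gaussCDF_zero] at hmw
      have hG : gaussCDF (v / d) - 1 / 2 ≤ κ * (v + 1 / 2) := by
        rcases le_total v (1 / 2) with h | h
        · have : gaussCDF (v / d) ≤ gaussCDF (1 / (2 * d)) := by
            refine strictMono_gaussCDF.monotone ?_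
            rw [← div_div]
            gcongr
          nlinarith
        · have := gaussCDF_mul_sub_half_le (s := 2 * v) (x := 1 / (2 * d)) (by linarith)
            (by positivity)
          rw [show 2 * v * (1 / (2 * d)) = v / d by field_simp] at this
          nlinarith
      rw [gaussCDF_neg]
      nlinarith
    · have : σ (-(v / d)) ≤ σ 0 := hm (neg_nonpos.2 (by positivity))
      have : d * -(v / d) = -v := by field_simp
      linarith
  · have hcont : Continuous σ := by
      have := hc.continuousOn isOpen_univ
      exact continuousOn_univ.1 this
    obtain ⟨T, hT, hT1⟩ : ∃ T ∈ Icc 0 (1 / d), d * T + σ T = 1 := by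
      refine intermediate_value_Icc (f := fun T => d * T + σ T) (by positivity) (by fun_prop)
        ⟨by simp; exact hw.le, ?_⟩
      have : d * (1 / d) = 1 := by field_simp
      simp only [this]
      linarith [h0 (1 / d)]
    refine le_trans ?_ (hbase T hT1.le)
    rcases le_total T (1 / (2 * d)) with h | h
    · have h1 := two_mul_mul_one_sub_gaussCDF_le_integral hc h0 hi hT.1
      have h2 : 1 / 2 ≤ σ T := by
        have : d * T ≤ d * (1 / (2 * d)) := by gcongr
        have : d * (1 / (2 * d)) = 1 / 2 := by field_simp
        linarith
      have h3 := (gaussCDF_mem T).2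
      have h4 : 1 / 2 ≤ gaussCDF T := by
        rw [← gaussCDF_zero]; exact strictMono_gaussCDF.monotone hT.1
      have h5 : 1 - gaussCDF T ≤ m := le_trans (by nlinarith) h1
      have h6 : κ * (1 / 2 - m) ≤ κ * (gaussCDF T - 1 / 2) :=
        mul_le_mul_of_nonneg_left (by linarith) hκ0
      have h7 : κ * (gaussCDF T - 1 / 2) ≤ gaussCDF T - 1 / 2 :=
        mul_le_of_le_one_left (by linarith) hκ1
      linarith
    · have : gaussCDF (1 / (2 * d)) ≤ gaussCDF T := strictMono_gaussCDF.monotone h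
      nlinarith

section Median

open scoped RealInnerProductSpace

variable {E : Type*} [NormedAddCommGroup E] [InnerProductSpace ℝ E] [FiniteDimensional ℝ E]
  [MeasurableSpace E] [BorelSpace E]

lemma stdGaussian_conv_self :
    ProbabilityTheory.stdGaussian E ∗ ProbabilityTheory.stdGaussian E =
      (ProbabilityTheory.stdGaussian E).map (fun x => √2 • x) := by
  have : IsProbabilityMeasure ((ProbabilityTheory.stdGaussian E).map (fun x => √2 • x)) :=
    Measure.isProbabilityMeasure_map (by fun_prop)
  refine Measure.ext_of_charFun ?_
  ext t
  rw [charFun_conv, charFun_map_smul, charFun_stdGaussian, charFun_stdGaussian, norm_smul,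
    ← Complex.exp_add]
  congr 1
  simp only [norm_eq_abs, abs_of_nonneg (sqrt_nonneg _), mul_pow, Complex.ofReal_mul]
  rw [← Complex.ofReal_pow (√2), sq_sqrt (by norm_num)]
  push_cast
  ring

lemma stdGaussian_map_neg :
    (ProbabilityTheory.stdGaussian E).map (fun x => -x) = ProbabilityTheory.stdGaussian E :=
  stdGaussian_map (LinearIsometryEquiv.neg ℝ (E := E))

/-- Resampling one coordinate of a standard Gaussian vector preserves its law. -/
lemma stdGaussian_conv_line {e : E} (he : ‖e‖ = 1) :
    (ProbabilityTheory.stdGaussian E).map (fun x => x - ⟪x, e⟫ • e) ∗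
      (gaussianReal 0 1).map (fun τ => τ • e) = ProbabilityTheory.stdGaussian E := by
  have h1 : IsProbabilityMeasure
      ((ProbabilityTheory.stdGaussian E).map (fun x => x - ⟪x, e⟫ • e)) :=
    Measure.isProbabilityMeasure_map (by fun_prop)
  have h2 : IsProbabilityMeasure ((gaussianReal 0 1).map (fun τ => τ • e)) :=
    Measure.isProbabilityMeasure_map (by fun_prop)
  refine Measure.ext_of_charFun ?_
  ext t
  have h3 : charFun ((ProbabilityTheory.stdGaussian E).map (fun x => x - ⟪x, e⟫ • e)) t =
      charFun (ProbabilityTheory.stdGaussian E) (t - ⟪e, t⟫ • e) := by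
    rw [charFun_apply, charFun_apply, integral_map (by fun_prop) (by fun_prop)]
    refine integral_congr_ae (Filter.Eventually.of_forall fun x => ?_)
    simp only [inner_sub_left, inner_sub_right, inner_smul_left, inner_smul_right]
    simp [mul_comm]
  have h4 : charFun ((gaussianReal 0 1).map (fun τ => τ • e)) t =
      charFun (gaussianReal 0 1) ⟪e, t⟫ := by
    rw [charFun_apply, charFun_apply, integral_map (by fun_prop) (by fun_prop)]
    refine integral_congr_ae (Filter.Eventually.of_forall fun x => ?_)
    simp [inner_smul_left, mul_comm]
  have h5 : ‖t - ⟪e, t⟫ • e‖ ^ 2 = ‖t‖ ^ 2 - ⟪e, t⟫ ^ 2 := by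
    rw [norm_sub_sq_real, norm_smul, he, inner_smul_right, real_inner_comm, mul_one, norm_eq_abs,
      sq_abs]
    ring
  rw [charFun_conv, h3, h4, charFun_stdGaussian, charFun_stdGaussian, charFun_gaussianReal,
    ← Complex.exp_add, ← Complex.ofReal_pow, h5]
  congr 1
  push_cast
  ring

/-- If a convex function `u` dominates a linear functional `⟪ξ, ·⟫`, grows at least as fast as it in
the direction `ξ`, and has small mean, then its Gaussian median is at most twice that mean. -/
theorem half_le_stdGaussian_real_of_integral_le {u : E → ℝ} (hu : ConvexOn ℝ univ u)
    (hi : Integrable u (ProbabilityTheory.stdGaussian E)) {ξ : E} (hξ : ∀ y, ⟪ξ, y⟫ ≤ u y)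
    (hmono : ∀ y t, 0 ≤ t → u y + t * ‖ξ‖ ^ 2 ≤ u (y + t • ξ)) {δ : ℝ} (hδ : 0 < δ)
    (hle : ∫ y, u y ∂ProbabilityTheory.stdGaussian E ≤ δ / 2) :
    1 / 2 ≤ (ProbabilityTheory.stdGaussian E).real {y | u y ≤ δ} := by
  have hcont : Continuous u := continuousOn_univ.1 (hu.continuousOn isOpen_univ)
  rcases eq_or_ne ξ 0 with rfl | hne
  · have hm := mul_meas_ge_le_integral_of_nonneg
      (Filter.Eventually.of_forall fun y => (by simpa using hξ y : 0 ≤ u y)) hi δ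
    have hK : MeasurableSet {y | u y ≤ δ} := measurableSet_le hcont.measurable measurable_const
    have hc := probReal_add_probReal_compl (μ := ProbabilityTheory.stdGaussian E) hK
    have hs : (ProbabilityTheory.stdGaussian E).real {y | u y ≤ δ}ᶜ ≤
        (ProbabilityTheory.stdGaussian E).real {y | δ ≤ u y} :=
      measureReal_mono fun y (hy : ¬u y ≤ δ) => (not_le.1 hy).le
    nlinarith
  set a := ‖ξ‖ with ha
  have ha0 : 0 < a := norm_pos_iff.2 hne
  obtain ⟨e, he'⟩ : ∃ e : E, e = a⁻¹ • ξ := ⟨_, rfl⟩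
  have he : ‖e‖ = 1 := by rw [he', norm_smul, norm_inv, norm_norm, inv_mul_cancel₀ ha0.ne']
  have hξe : ξ = a • e := by rw [he', smul_smul, mul_inv_cancel₀ ha0.ne', one_smul]
  have hee : ⟪e, e⟫ = 1 := by rw [real_inner_self_eq_norm_sq, he]; norm_num
  let P : E → E := fun x => x - ⟪x, e⟫ • e
  have hPe : ∀ x τ, ⟪ξ, P x + τ • e⟫ = a * τ := by
    intro x τ
    simp only [P]
    rw [hξe, real_inner_smul_left, inner_add_right, inner_sub_right, inner_smul_right,
      inner_smul_right, hee, real_inner_comm]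
    ring
  set N := gaussianReal 0 1
  have hlaw : ((ProbabilityTheory.stdGaussian E).prod N).map (fun p => P p.1 + p.2 • e) =
      ProbabilityTheory.stdGaussian E := by
    conv_rhs => rw [← stdGaussian_conv_line he]
    rw [Measure.conv, Measure.map_prod_map _ _ (by fun_prop) (by fun_prop),
      Measure.map_map (by fun_prop) (by fun_prop)]
    rfl
  have hmeas : Measurable fun p : E × ℝ => P p.1 + p.2 • e := by fun_prop
  have hint : ∀ g : E → ℝ, Integrable g (ProbabilityTheory.stdGaussian E) → Measurable g →
      Integrable (fun p : E × ℝ => g (P p.1 + p.2 • e))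
        ((ProbabilityTheory.stdGaussian E).prod N) := by
    intro g hg _
    rw [← hlaw] at hg
    exact hg.comp_measurable hmeas
  have hfub : ∀ g : E → ℝ, Integrable g (ProbabilityTheory.stdGaussian E) → Measurable g →
      ∫ y, g y ∂ProbabilityTheory.stdGaussian E =
        ∫ x, ∫ τ, g (P x + τ • e) ∂N ∂ProbabilityTheory.stdGaussian E := by
    intro g hg hgm
    conv_lhs => rw [← hlaw]
    rw [integral_map hmeas.aemeasurable hgm.aestronglyMeasurable, integral_prod _ (hint g hg hgm)]
  have hK : MeasurableSet {y | u y ≤ δ} := measurableSet_le hcont.measurable measurable_const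
  have hKi : Integrable (indicator {y | u y ≤ δ} (1 : E → ℝ)) (ProbabilityTheory.stdGaussian E) :=
    (integrable_const (1 : ℝ)).indicator hK
  have hKm : Measurable (indicator {y | u y ≤ δ} (1 : E → ℝ)) := measurable_one.indicator hK
  have hN0 : ∫ τ, τ ∂N = 0 := integral_id_gaussianReal
  have hNi : Integrable (fun τ => τ) N := IsGaussian.integrable_id
  rw [← integral_indicator_one hK, hfub _ hKi hKm]
  set κ := 2 * gaussCDF (1 / (2 * (a / δ))) - 1 with hκ
  have hκ0 : 0 ≤ κ := by
    have : gaussCDF 0 ≤ gaussCDF (1 / (2 * (a / δ))) :=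
      strictMono_gaussCDF.monotone (by positivity)
    rw [gaussCDF_zero] at this
    linarith
  have hui := hint u hi hcont.measurable
  have hae : ∀ᵐ x ∂ProbabilityTheory.stdGaussian E,
      1 / 2 + κ * (1 / 2 - (∫ τ, u (P x + τ • e) ∂N) / δ) ≤
        ∫ τ, indicator {y | u y ≤ δ} (1 : E → ℝ) (P x + τ • e) ∂N := by
    filter_upwards [hui.prod_right_ae] with x hx
    have hx' : Integrable (fun τ => (u (P x + τ • e) - a * τ) / δ) N :=
      (hx.sub (hNi.const_mul a)).div_const δ
    have hconv : ConvexOn ℝ univ fun τ => (u (P x + τ • e) - a * τ) / δ := by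
      refine ⟨convex_univ, fun τ _ τ' _ b b' hb hb' hbb => ?_⟩
      have := hu.2 (mem_univ (P x + τ • e)) (mem_univ (P x + τ' • e)) hb hb' hbb
      rw [show b • (P x + τ • e) + b' • (P x + τ' • e) = P x + (b * τ + b' * τ') • e by
        rw [smul_add, smul_add, add_smul, smul_smul, smul_smul, add_add_add_comm, ← add_smul, hbb,
          one_smul]] at this
      simp only [smul_eq_mul] at this ⊢
      rw [← mul_div_assoc, ← mul_div_assoc, ← add_div]
      gcongr
      linarith
    have hmon : Monotone fun τ => (u (P x + τ • e) - a * τ) / δ := by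
      intro τ τ' h
      have := hmono (P x + τ • e) ((τ' - τ) / a) (div_nonneg (sub_nonneg.2 h) ha0.le)
      rw [show P x + τ • e + ((τ' - τ) / a) • ξ = P x + τ' • e by
        rw [hξe, smul_smul, div_mul_cancel₀ _ ha0.ne', add_assoc, ← add_smul, add_sub_cancel],
        show (τ' - τ) / a * a ^ 2 = a * (τ' - τ) by field_simp] at this
      beta_reduce
      gcongr ?_ / δ
      linarith
    have hnn : ∀ τ, 0 ≤ (u (P x + τ • e) - a * τ) / δ := fun τ =>
      div_nonneg (by linarith [hξ (P x + τ • e), hPe x τ]) hδ.le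
    have key := half_add_le_gaussianReal_real hconv hmon hnn hx' (div_pos ha0 hδ)
    rw [integral_div, integral_sub hx (hNi.const_mul a), integral_const_mul, hN0, mul_zero,
      sub_zero] at key
    refine key.trans_eq ?_
    have hset : {τ : ℝ | a / δ * τ + (u (P x + τ • e) - a * τ) / δ ≤ 1} =
        {τ | u (P x + τ • e) ≤ δ} := by
      ext τ
      rw [Set.mem_ofPred_eq, Set.mem_ofPred_eq,
        show a / δ * τ + (u (P x + τ • e) - a * τ) / δ = u (P x + τ • e) / δ by ring, div_le_one hδ]
    rw [hset, ← integral_indicator_one (measurableSet_le (by fun_prop) measurable_const)]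
    rfl
  have hL : Integrable (fun x => ∫ τ, u (P x + τ • e) ∂N) (ProbabilityTheory.stdGaussian E) :=
    hui.integral_prod_left
  have hD : Integrable (fun x => 1 / 2 - (∫ τ, u (P x + τ • e) ∂N) / δ)
      (ProbabilityTheory.stdGaussian E) := (integrable_const _).sub (hL.div_const δ)
  refine le_trans ?_ (integral_mono_ae ((integrable_const _).add (hD.const_mul κ))
    (hint _ hKi hKm).integral_prod_left hae)
  have hL' := hfub u hi hcont.measurable
  rw [integral_add' (integrable_const _) (hD.const_mul κ), integral_const_mul,
    integral_sub (integrable_const _) (hL.div_const δ),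
    integral_div δ fun x => ∫ τ, u (P x + τ • e) ∂N, ← hL']
  simp only [integral_const, probReal_univ, one_smul]
  have : (∫ y, u y ∂ProbabilityTheory.stdGaussian E) / δ ≤ 1 / 2 := by
    rw [div_le_iff₀ hδ]; linarith
  nlinarith

end Median

section LargeDeviations

open scoped RealInnerProductSpace

variable {E : Type*} [NormedAddCommGroup E] [InnerProductSpace ℝ E] [FiniteDimensional ℝ E]

/-- The least-norm element `ξ` of the closed convex hull of a bounded set satisfies
`⟪ξ, η⟫ ≥ ‖ξ‖ ^ 2` on that set; this is the resulting property of the support function. -/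
lemma exists_inner_le_iSup_inner {ι : Type*} [Nonempty ι] {v : ι → E}
    (hbdd : ∀ x, BddAbove (range fun i => ⟪v i, x⟫)) :
    ∃ ξ : E, (∀ x, ⟪ξ, x⟫ ≤ ⨆ i, ⟪v i, x⟫) ∧
      ∀ x t, 0 ≤ t → (⨆ i, ⟪v i, x⟫) + t * ‖ξ‖ ^ 2 ≤ ⨆ i, ⟪v i, x + t • ξ⟫ := by
  have hc : Convex ℝ (closure (convexHull ℝ (range v))) := (convex_convexHull ℝ _).closure
  have hsub : range v ⊆ closure (convexHull ℝ (range v)) :=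
    (subset_convexHull ℝ _).trans subset_closure
  obtain ⟨ξ, hξ, hmin⟩ := exists_norm_eq_iInf_of_complete_convex
    ((range_nonempty v).mono hsub) isClosed_closure.isComplete hc 0
  rw [norm_eq_iInf_iff_real_inner_le_zero hc hξ] at hmin
  refine ⟨ξ, fun x => ?_, fun x t ht => ?_⟩
  · have hH : closure (convexHull ℝ (range v)) ⊆ {η | ⟪x, η⟫ ≤ ⨆ i, ⟪v i, x⟫} := by
      refine closure_minimal (convexHull_min ?_ ?_) (isClosed_le (by fun_prop) continuous_const)
      · rintro _ ⟨i, rfl⟩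
        rw [Set.mem_ofPred_eq, real_inner_comm]
        exact le_ciSup (hbdd x) i
      · exact convex_halfSpace_le ((innerₛₗ ℝ x).isLinear) _
    rw [real_inner_comm]
    exact hH hξ
  · rw [← le_sub_iff_add_le]
    refine ciSup_le fun i => ?_
    have h1 := hmin (v i) (hsub (mem_range_self i))
    rw [zero_sub, inner_neg_left, inner_sub_right, real_inner_self_eq_norm_sq,
      real_inner_comm] at h1
    have h2 := le_ciSup (hbdd (x + t • ξ)) i
    simp only [inner_add_right, inner_smul_right] at h2 ⊢
    nlinarith

variable [MeasurableSpace E] [BorelSpace E]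

/-- A one-sided large deviation bound for functions whose increments are controlled by the support
function of a family of vectors with small Gaussian mean width. -/
theorem stdGaussian_real_le_exp_of_sub_le_iSup {ι : Type*} [Nonempty ι] {v : ι → E}
    (hbdd : ∀ x, BddAbove (range fun i => ⟪v i, x⟫))
    (hi : Integrable (fun x => ⨆ i, ⟪v i, x⟫) (ProbabilityTheory.stdGaussian E))
    {f : E → ℝ} (hf : ∀ a b, f b - f a ≤ ⨆ i, ⟪v i, b - a⟫)
    (hfi : ∀ h, Integrable (fun x => f (x + h)) (ProbabilityTheory.stdGaussian E))
    {δ : ℝ} (hδ : 0 < δ)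
    (hle : ∫ x, (⨆ i, ⟪v i, x⟫) ∂ProbabilityTheory.stdGaussian E ≤ δ / (2 * √2))
    {t r : ℝ} (hr : 0 ≤ r)
    (hrf : ∀ h, t - δ ≤ ∫ x, f (x + h) ∂ProbabilityTheory.stdGaussian E → r ≤ ‖h‖) :
    (ProbabilityTheory.stdGaussian E).real {x | t ≤ f x} ≤ exp (-r ^ 2 / 2) := by
  rcases hr.eq_or_lt with rfl | hr
  · simp [measureReal_le_one]
  obtain ⟨ξ, hξ, hmono⟩ := exists_inner_le_iSup_inner hbdd
  obtain ⟨s, hs⟩ : ∃ s : E → ℝ, s = fun x => ⨆ i, ⟪v i, x⟫ := ⟨_, rfl⟩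
  have hs' : ∀ x, ⨆ i, ⟪v i, x⟫ = s x := fun x => by rw [hs]
  simp only [hs'] at hi hf hle hξ hmono
  have hadd : ∀ x y, s (x + y) ≤ s x + s y := fun x y => by
    rw [hs]
    refine ciSup_le fun i => ?_
    rw [inner_add_right]
    exact add_le_add (le_ciSup (hbdd x) i) (le_ciSup (hbdd y) i)
  have hsmul : ∀ (c : ℝ) x, 0 ≤ c → s (c • x) = c * s x := fun c x hc => by
    simp only [hs, inner_smul_right]
    exact (Real.mul_iSup_of_nonneg hc _).symm
  clear hs' hs
  have hconv : ConvexOn ℝ univ s := by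
    refine ⟨convex_univ, fun x _ y _ a b ha hb _ => ?_⟩
    simpa only [hsmul _ _ ha, hsmul _ _ hb, smul_eq_mul] using hadd (a • x) (b • y)
  have hcont : Continuous s := continuousOn_univ.1 (hconv.continuousOn isOpen_univ)
  obtain ⟨γ, hγ⟩ : ∃ γ, γ = ProbabilityTheory.stdGaussian E := ⟨_, rfl⟩
  have hγp : IsProbabilityMeasure γ := by rw [hγ]; infer_instance
  rw [← hγ] at hi hle ⊢
  simp only [← hγ] at hfi hrf
  have hint : ∀ y, Integrable (fun x => s (y + x)) γ := fun y => by
    refine integrable_of_le_of_le (hcont.comp (by fun_prop)).aestronglyMeasurable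
      (Filter.Eventually.of_forall fun x => ?_) (Filter.Eventually.of_forall fun x => hadd y x)
      (hi.sub (integrable_const (s (-y)))) ((integrable_const (s y)).add hi)
    have := hadd (-y) (y + x)
    rw [neg_add_cancel_left] at this
    simp only [Pi.sub_apply]
    linarith
  obtain ⟨u, hu⟩ : ∃ u : E → ℝ, ∀ y, u y = ∫ x, s (y + x) ∂γ := ⟨_, fun _ => rfl⟩
  have hneg : ∀ y, u y = ∫ x, s (y - x) ∂γ := fun y => by
    rw [hu, hγ]
    conv_lhs => rw [← stdGaussian_map_neg]
    rw [integral_map (by fun_prop) (by fun_prop)]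
    simp only [sub_eq_add_neg]
  have hint' : ∀ y, Integrable (fun x => s (y - x)) γ := fun y => by
    have := hint y
    rw [hγ, ← stdGaussian_map_neg] at this
    simpa only [sub_eq_add_neg, hγ, Function.comp_def] using this.comp_measurable measurable_neg
  have huconv : ConvexOn ℝ univ u := by
    refine ⟨convex_univ, fun x _ y _ a b ha hb hab => ?_⟩
    simp only [hu, smul_eq_mul]
    rw [← integral_const_mul, ← integral_const_mul,
      ← integral_add ((hint x).const_mul a) ((hint y).const_mul b)]
    refine integral_mono (hint _) (((hint x).const_mul a).add ((hint y).const_mul b)) fun z => ?_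
    have := hconv.2 (mem_univ (x + z)) (mem_univ (y + z)) ha hb hab
    rwa [smul_add, smul_add, add_add_add_comm, ← add_smul, hab, one_smul] at this
  have hucont : Continuous u := continuousOn_univ.1 (huconv.continuousOn isOpen_univ)
  have hm : MeasurePreserving (fun p : E × E => p.1 + p.2) (γ.prod γ)
      (γ.map fun x => √2 • x) :=
    ⟨by fun_prop, by rw [hγ, ← stdGaussian_conv_self, Measure.conv]⟩
  have hi2 : Integrable s (γ.map fun x => √2 • x) := by
    rw [integrable_map_measure hcont.aestronglyMeasurable (by fun_prop)]
    simpa only [Function.comp_def, hsmul _ _ (sqrt_nonneg 2)] using hi.const_mul √2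
  have hprod : Integrable (fun p : E × E => s (p.1 + p.2)) (γ.prod γ) :=
    hm.integrable_comp_of_integrable hi2
  have hui : Integrable u γ := by
    simpa only [← hu] using hprod.integral_prod_left
  have huint : ∫ y, u y ∂γ = √2 * ∫ x, s x ∂γ := by
    simp only [hu]
    rw [← integral_prod _ hprod, ← integral_const_mul]
    have := integral_map hm.aemeasurable (hm.map_eq ▸ hcont.aestronglyMeasurable)
      (f := s)
    rw [← this, hm.map_eq, integral_map (by fun_prop) hcont.aestronglyMeasurable]
    simp only [hsmul _ _ (sqrt_nonneg 2)]
  have huξ : ∀ y, ⟪ξ, y⟫ ≤ u y := fun y => by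
    have h0 : ∫ x, ⟪ξ, x⟫ ∂γ = 0 := by
      rw [hγ]; exact integral_strongDual_stdGaussian (innerSL ℝ ξ)
    have h1 : Integrable (fun x => ⟪ξ, x⟫) γ := by
      rw [hγ]; exact (innerSL ℝ ξ).integrable_comp IsGaussian.integrable_id
    have h2 := integral_mono ((integrable_const ⟪ξ, y⟫).add h1) (hint y) fun x => by
      simpa only [Pi.add_apply, inner_add_right] using hξ (y + x)
    rw [integral_add' (integrable_const _) h1, h0, integral_const] at h2
    simpa [hu] using h2
  have humono : ∀ y t, 0 ≤ t → u y + t * ‖ξ‖ ^ 2 ≤ u (y + t • ξ) := fun y t ht => by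
    have h2 := integral_mono ((hint y).add (integrable_const (t * ‖ξ‖ ^ 2))) (hint (y + t • ξ))
      fun x => by simpa only [Pi.add_apply, add_right_comm y] using hmono (y + x) t ht
    rw [integral_add' (hint y) (integrable_const _), integral_const] at h2
    simpa [hu] using h2
  have hhalf : 1 / 2 ≤ γ.real {y | u y ≤ δ} := by
    rw [hγ]
    rw [hγ] at hui huint hle
    refine half_le_stdGaussian_real_of_integral_le huconv hui huξ humono hδ ?_
    rw [huint]
    calc √2 * ∫ x, s x ∂ProbabilityTheory.stdGaussian E ≤ √2 * (δ / (2 * √2)) := by gcongr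
      _ = δ / 2 := by field_simp
  have hne : {y | u y ≤ δ}.Nonempty := by
    by_contra h
    rw [not_nonempty_iff_eq_empty.1 h, measureReal_empty] at hhalf
    norm_num at hhalf
  have hcl : IsClosed {y | u y ≤ δ} := isClosed_le hucont continuous_const
  have hKc : Convex ℝ {y | u y ≤ δ} := by simpa using huconv.convex_le δ
  have hsub : {x | t ≤ f x} ⊆ {y | r ≤ Metric.infDist y {y | u y ≤ δ}} := by
    intro x hx
    rw [Set.mem_ofPred_eq] at hx ⊢
    refine (Metric.le_infDist hne).2 fun y hy => ?_
    rw [Set.mem_ofPred_eq] at hy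
    rw [dist_eq_norm]
    refine hrf (x - y) ?_
    have h1 := integral_mono ((integrable_const (f x)).sub (hfi (x - y))) (hint' y) fun z => by
      have := hf (z + (x - y)) x
      rwa [show x - (z + (x - y)) = y - z by abel] at this
    rw [integral_sub' (integrable_const _) (hfi _), integral_const, ← hneg] at h1
    simp only [probReal_univ, one_smul] at h1
    linarith
  calc γ.real {x | t ≤ f x} ≤ γ.real {y | r ≤ Metric.infDist y {y | u y ≤ δ}} :=
        measureReal_mono hsub
    _ ≤ 1 - gaussCDF r := by
        rw [hγ] at hhalf ⊢
        exact stdGaussian_real_le_infDist_le hcl hKc hhalf hr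
    _ ≤ exp (-r ^ 2 / 2) := one_sub_gaussCDF_le hr.le

end LargeDeviations

lemma sub_le_iSup_gradVec {n : ℕ} {f : (Fin n → ℝ) → ℝ} (hf : Differentiable ℝ f)
    (hbdd : ∀ x : Fin n → ℝ,
      BddAbove (Set.range fun y : Fin n → ℝ => ∑ i, gradVec n f y i * x i)) (a b : Fin n → ℝ) :
    f b - f a ≤ ⨆ y : Fin n → ℝ, ∑ i, gradVec n f y i * (b - a) i := by
  obtain ⟨c, -, hc⟩ := domain_mvt (s := univ) (f := f) (f' := fderiv ℝ f)
    (fun x _ => (hf x).hasFDerivAt.hasFDerivWithinAt) convex_univ (mem_univ a) (mem_univ b)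
  refine le_trans (le_of_eq ?_) (le_ciSup (hbdd (b - a)) c)
  rw [hc]
  conv_lhs => rw [pi_eq_sum_univ' (b - a), map_sum]
  refine Finset.sum_congr rfl fun i _ => ?_
  rw [map_smul, smul_eq_mul, mul_comm, gradVec]

/-- **Gaussian nonlinear large deviations.** Let `X` be standard Gaussian on `ℝⁿ`, `f`
continuously differentiable, `ψ(t) = inf {‖h‖²/2 : E f(X+h) ≥ t}`, and `t ∈ ℝ`, `δ > 0`
with `ψ(s) > ψ(t-δ)` for all `s > t-δ`. If the Gaussian mean-width of `V = ∇f(ℝⁿ)`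
satisfies `g(V) ≤ δ/(2√2)`, then `log P(f(X) ≥ t) ≤ -ψ(t-δ)`. -/
theorem gaussian_nonlinear_large_deviations (n : ℕ) (f : (Fin n → ℝ) → ℝ)
    (hf : ContDiff ℝ 1 f)
    (hshift : ∀ h : Fin n → ℝ, Integrable (fun x => f (x + h)) (stdGaussian n))
    (hbdd : ∀ x : Fin n → ℝ,
      BddAbove (Set.range fun y : Fin n → ℝ => ∑ i, gradVec n f y i * x i))
    (hgfin : Integrable
      (fun x => ⨆ y : Fin n → ℝ, ∑ i, gradVec n f y i * x i) (stdGaussian n))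
    (ψ : ℝ → ℝ)
    (hψ : ψ = fun s => sInf ((fun h : Fin n → ℝ => (∑ i, (h i) ^ 2) / 2) ''
      {h | s ≤ ∫ x, f (x + h) ∂stdGaussian n}))
    (t δ : ℝ) (hδ : 0 < δ)
    (hstrict : ∀ s, t - δ < s → ψ (t - δ) < ψ s)
    (hwidth : (∫ x, (⨆ y : Fin n → ℝ, ∑ i, gradVec n f y i * x i) ∂stdGaussian n) ≤
      δ / (2 * Real.sqrt 2)) :
    ENNReal.log (stdGaussian n {x | t ≤ f x}) ≤ ((- ψ (t - δ) : ℝ) : EReal) := by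
  have hP : IsProbabilityMeasure (_root_.stdGaussian n) := by
    unfold _root_.stdGaussian; infer_instance
  let T := MeasurableEquiv.toLp 2 (Fin n → ℝ)
  have hT : MeasurePreserving T (_root_.stdGaussian n)
      (ProbabilityTheory.stdGaussian (EuclideanSpace ℝ (Fin n))) :=
    ⟨T.measurable, map_pi_eq_stdGaussian⟩
  let v : (Fin n → ℝ) → EuclideanSpace ℝ (Fin n) := fun y => WithLp.toLp 2 (gradVec n f y)
  have hinner : ∀ y (x : EuclideanSpace ℝ (Fin n)),
      inner ℝ (v y) x = ∑ i, gradVec n f y i * x i := by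
    intro y x
    simp [v, PiLp.inner_apply, mul_comm]
  have hm0 : 0 ≤ ψ (t - δ) := by
    rw [hψ]
    refine Real.sInf_nonneg ?_
    rintro _ ⟨h, -, rfl⟩
    positivity
  have key := stdGaussian_real_le_exp_of_sub_le_iSup (v := v) (f := fun x => f x.ofLp) (δ := δ)
    (t := t) (r := √(2 * ψ (t - δ))) ?_ ?_ ?_ ?_ hδ ?_ (sqrt_nonneg _) ?_
  · rw [sq_sqrt (by positivity), neg_div, mul_div_cancel_left₀ _ two_ne_zero, measureReal_def,
      ← hT.measure_preimage_equiv] at key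
    have h := log_le_log
      ((ENNReal.le_ofReal_iff_toReal_le (measure_ne_top _ _) (exp_pos _).le).2 key)
    rwa [log_ofReal_of_pos (exp_pos _), Real.log_exp] at h
  · intro x
    simpa only [hinner] using hbdd x.ofLp
  · simp only [hinner]
    exact (hT.integrable_comp_emb T.measurableEmbedding).1 hgfin
  · intro a b
    simp only [hinner]
    exact sub_le_iSup_gradVec (hf.differentiable one_ne_zero) hbdd a.ofLp b.ofLp
  · intro h
    exact (hT.integrable_comp_emb T.measurableEmbedding).1 (hshift h.ofLp)
  · simp only [hinner]
    rw [← hT.integral_comp T.measurableEmbedding]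
    exact hwidth
  · intro h hh
    rw [← hT.integral_comp T.measurableEmbedding] at hh
    have : ψ (t - δ) ≤ (∑ i, h i ^ 2) / 2 := by
      rw [hψ]
      refine csInf_le ⟨0, ?_⟩ ⟨h.ofLp, hh, rfl⟩
      rintro _ ⟨h, -, rfl⟩
      positivity
    refine sqrt_le_iff.2 ⟨norm_nonneg h, ?_⟩
    rw [EuclideanSpace.real_norm_sq_eq]
    linarith
end

section
/- Let μ be a probability measure on ℝ^n with mean 0 such that the domain of its log-Laplace transform Λ_μ(ξ) = log ∫ e^{⟨ξ,x⟩} dμ(x) has nonempty interior and such that the Legendre transform Λ*_μ is strictly convex on its domain. If μ satisfies the transportation-entropy inequality W_c(ν,μ) ≤ H(ν|μ) for all probability measures ν on ℝ^n, with cost c(x,y) = Λ*_μ(x-y), then μ is a centered Gaussian measure on ℝ^n. -/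
open MeasureTheory Real Set ENNReal
open scoped Classical

/-- The transportation cost `W_c(ν, μ)`: infimum of `∫ c dπ` over all couplings `π`
of `ν` and `μ`. -/
noncomputable def transportCost {E F : Type*} [MeasurableSpace E] [MeasurableSpace F]
    (c : E → F → ℝ≥0∞) (ν : Measure E) (μ : Measure F) : ℝ≥0∞ :=
  ⨅ (P : Measure (E × F)) (_ : P.map Prod.fst = ν) (_ : P.map Prod.snd = μ),
    ∫⁻ p, c p.1 p.2 ∂P

/-- The relative entropy `H(ν|μ) = ∫ log (dν/dμ) dν` if `ν ≪ μ` (and the integral is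
well defined), and `+∞` otherwise.  (Since the negative part of `log (dν/dμ)` is always
`ν`-integrable for probability measures, non-integrability corresponds to `H = +∞`.) -/

noncomputable def relEntropy {E : Type*} [MeasurableSpace E] (ν μ : Measure E) : ℝ≥0∞ :=
  if ν ≪ μ ∧ Integrable (fun x => Real.log ((ν.rnDeriv μ x).toReal)) ν
  then ENNReal.ofReal (∫ x, Real.log ((ν.rnDeriv μ x).toReal) ∂ν) else ⊤

/-- The logarithmic Laplace transform `Λ_μ(ξ) = log ∫ e^{⟨ξ,x⟩} dμ(x)`, with values in
`EReal` (it may be `+∞`). -/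
noncomputable def logLaplaceE (n : ℕ) (μ : Measure (Fin n → ℝ)) (ξ : Fin n → ℝ) : EReal :=
  ENNReal.log (∫⁻ x, ENNReal.ofReal (Real.exp (∑ i, ξ i * x i)) ∂μ)

/-- The Legendre transform `Λ*_μ(x) = sup_ξ (⟨ξ,x⟩ - Λ_μ(ξ))` of the log-Laplace
transform, with values in `EReal`. -/
noncomputable def legendreE (n : ℕ) (μ : Measure (Fin n → ℝ)) (x : Fin n → ℝ) : EReal :=
  ⨆ ξ : Fin n → ℝ, (((∑ i, ξ i * x i : ℝ) : EReal) - logLaplaceE n μ ξ)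

/-- Conversion `EReal → ℝ≥0∞` (sending `+∞` to `+∞` and negative values to `0`). -/
noncomputable def eRealToENN (a : EReal) : ℝ≥0∞ :=
  if a = ⊤ then ⊤ else ENNReal.ofReal a.toReal

section Preliminaries

variable {n : ℕ} {μ : Measure (Fin n → ℝ)}

/-- The real-valued log-Laplace transform; meaningful where `exp ⟨ξ, ·⟩` is integrable. -/
noncomputable def logLaplace (μ : Measure (Fin n → ℝ)) (ξ : Fin n → ℝ) : ℝ :=
  Real.log (∫ x, Real.exp (ξ ⬝ᵥ x) ∂μ)

lemma continuous_dotProduct_left (ξ : Fin n → ℝ) : Continuous fun x : Fin n → ℝ => ξ ⬝ᵥ x := by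
  unfold dotProduct; fun_prop

lemma measurable_dotProduct_left (ξ : Fin n → ℝ) : Measurable fun x : Fin n → ℝ => ξ ⬝ᵥ x :=
  (continuous_dotProduct_left ξ).measurable

lemma aestronglyMeasurable_exp_dotProduct (ξ : Fin n → ℝ) :
    AEStronglyMeasurable (fun x => Real.exp (ξ ⬝ᵥ x)) μ :=
  (Real.continuous_exp.comp (continuous_dotProduct_left ξ)).aestronglyMeasurable

lemma logLaplaceE_ne_top_iff (ξ : Fin n → ℝ) :
    logLaplaceE n μ ξ ≠ ⊤ ↔ Integrable (fun x => Real.exp (ξ ⬝ᵥ x)) μ := by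
  rw [logLaplaceE, Ne, ENNReal.log_eq_top_iff, ← Ne, ← lt_top_iff_ne_top,
    ← hasFiniteIntegral_iff_ofReal (ae_of_all _ fun x => (Real.exp_pos _).le)]
  exact ⟨fun h => ⟨aestronglyMeasurable_exp_dotProduct ξ, h⟩, fun h => h.2⟩

lemma logLaplaceE_eq_coe [NeZero μ] {ξ : Fin n → ℝ}
    (h : Integrable (fun x => Real.exp (ξ ⬝ᵥ x)) μ) :
    logLaplaceE n μ ξ = (logLaplace μ ξ : EReal) := by
  rw [logLaplace, ← ENNReal.log_ofReal_of_pos (integral_exp_pos h),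
    ofReal_integral_eq_lintegral_ofReal h (ae_of_all _ fun x => (Real.exp_pos _).le)]
  rfl

lemma le_legendreE [NeZero μ] {η : Fin n → ℝ} (h : Integrable (fun x => Real.exp (η ⬝ᵥ x)) μ)
    (z : Fin n → ℝ) : ((η ⬝ᵥ z - logLaplace μ η : ℝ) : EReal) ≤ legendreE n μ z := by
  refine le_trans (le_of_eq ?_) (le_iSup _ η)
  rw [logLaplaceE_eq_coe h, EReal.coe_sub]
  rfl

lemma legendreE_le [NeZero μ] {z : Fin n → ℝ} {K : ℝ}
    (h : ∀ η, Integrable (fun x => Real.exp (η ⬝ᵥ x)) μ → η ⬝ᵥ z - logLaplace μ η ≤ K) :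
    legendreE n μ z ≤ K := by
  refine iSup_le fun η => ?_
  by_cases hη : logLaplaceE n μ η = ⊤
  · simp [hη]
  · have hi := (logLaplaceE_ne_top_iff η).1 hη
    rw [logLaplaceE_eq_coe hi, ← EReal.coe_sub]
    exact_mod_cast h η hi

lemma exists_lt_of_coe_lt_legendreE [NeZero μ] {z : Fin n → ℝ} {K : ℝ}
    (h : (K : EReal) < legendreE n μ z) :
    ∃ η, Integrable (fun x => Real.exp (η ⬝ᵥ x)) μ ∧ K < η ⬝ᵥ z - logLaplace μ η := by
  by_contra! hc
  exact absurd (legendreE_le hc) (not_le.2 h)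

/-- If `⟨ξ, ·⟩ - Λ(ξ)` supports `Λ*` at `a`, then strict convexity makes the gap between the two
uniformly positive away from `a`. -/
lemma exists_gap_legendreE [NeZero μ] {ξ a : Fin n → ℝ}
    (hξ : Integrable (fun x => Real.exp (ξ ⬝ᵥ x)) μ)
    (ha : legendreE n μ a = ((ξ ⬝ᵥ a - logLaplace μ ξ : ℝ) : EReal))
    (hstrict : ∀ x ∈ {x : Fin n → ℝ | legendreE n μ x ≠ ⊤},
      ∀ y ∈ {x : Fin n → ℝ | legendreE n μ x ≠ ⊤}, x ≠ y → ∀ t : ℝ, 0 < t → t < 1 →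
      (legendreE n μ (t • x + (1 - t) • y)).toReal <
        t * (legendreE n μ x).toReal + (1 - t) * (legendreE n μ y).toReal)
    {r : ℝ} (hr : 0 < r) :
    ∃ δ > 0, ∀ z, r ≤ ‖z - a‖ →
      ((ξ ⬝ᵥ z - logLaplace μ ξ + δ : ℝ) : EReal) ≤ legendreE n μ z := by
  have hbot : ∀ z, legendreE n μ z ≠ ⊥ := fun z h => by
    have := le_legendreE hξ z
    rw [h] at this
    exact EReal.coe_ne_bot _ (le_bot_iff.1 this)
  have ha' : legendreE n μ a ≠ ⊤ := by rw [ha]; exact EReal.coe_ne_top _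
  -- on chords from `a`, convexity together with finiteness of the end point
  have chord : ∀ z, z ≠ a → legendreE n μ z ≠ ⊤ → ∀ t : ℝ, 0 < t → t < 1 → ∀ K : ℝ,
      ((K : ℝ) : EReal) ≤ legendreE n μ (t • z + (1 - t) • a) →
      legendreE n μ (t • z + (1 - t) • a) ≠ ⊤ →
      K < t * (legendreE n μ z).toReal + (1 - t) * (ξ ⬝ᵥ a - logLaplace μ ξ) := by
    intro z hza hz t ht ht1 K hK hne
    have h := hstrict z hz a ha' hza t ht ht1
    rw [ha, EReal.toReal_coe] at h
    refine lt_of_le_of_lt ?_ h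
    have := EReal.toReal_le_toReal hK (EReal.coe_ne_bot _) hne
    rwa [EReal.toReal_coe] at this
  have hconv : ∀ z, legendreE n μ z ≠ ⊤ → ∀ t : ℝ, 0 < t → t < 1 →
      legendreE n μ (t • z + (1 - t) • a) ≠ ⊤ := by
    intro z hz t ht ht1
    refine ne_top_of_le_ne_top (EReal.coe_ne_top
      (t * (legendreE n μ z).toReal + (1 - t) * (legendreE n μ a).toReal)) (legendreE_le ?_)
    intro η hη
    have h1 := EReal.toReal_le_toReal (le_legendreE hη z) (EReal.coe_ne_bot _) hz
    have h2 := EReal.toReal_le_toReal (le_legendreE hη a) (EReal.coe_ne_bot _) ha'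
    rw [EReal.toReal_coe] at h1 h2
    rw [dotProduct_add, dotProduct_smul, dotProduct_smul, smul_eq_mul, smul_eq_mul]
    nlinarith [mul_le_mul_of_nonneg_left h1 ht.le,
      mul_le_mul_of_nonneg_left h2 (sub_nonneg.2 ht1.le)]
  have hpos : ∀ w, w ≠ a → ((ξ ⬝ᵥ w - logLaplace μ ξ : ℝ) : EReal) < legendreE n μ w := by
    intro w hw
    refine lt_of_le_of_ne (le_legendreE hξ w) fun he => ?_
    have hwt : legendreE n μ w ≠ ⊤ := by rw [← he]; exact EReal.coe_ne_top _
    have h := chord w hw hwt (1 / 2) (by norm_num) (by norm_num) _ (le_legendreE hξ _)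
      (hconv w hwt _ (by norm_num) (by norm_num))
    rw [← he, EReal.toReal_coe, dotProduct_add, dotProduct_smul, dotProduct_smul, smul_eq_mul,
      smul_eq_mul] at h
    linarith
  have hsphere : ∃ δ > 0, ∀ w ∈ Metric.sphere a r,
      ((ξ ⬝ᵥ w - logLaplace μ ξ + δ : ℝ) : EReal) ≤ legendreE n μ w := by
    refine (isCompact_sphere a r).induction_on (p := fun s => ∃ δ > 0, ∀ w ∈ s,
      ((ξ ⬝ᵥ w - logLaplace μ ξ + δ : ℝ) : EReal) ≤ legendreE n μ w) ?_ ?_ ?_ ?_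
    · exact ⟨1, one_pos, by simp⟩
    · rintro s t hst ⟨δ, hδ, h⟩
      exact ⟨δ, hδ, fun w hw => h w (hst hw)⟩
    · rintro s t ⟨δ, hδ, h⟩ ⟨δ', hδ', h'⟩
      refine ⟨min δ δ', lt_min hδ hδ', fun w hw => ?_⟩
      rcases hw with hw | hw
      · exact le_trans (by exact_mod_cast by linarith [min_le_left δ δ']) (h w hw)
      · exact le_trans (by exact_mod_cast by linarith [min_le_right δ δ']) (h' w hw)
    · intro w hw
      have hwa : w ≠ a := by
        rintro rfl
        simp at hw
        exact hr.ne hw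
      obtain ⟨η, hη, hlt⟩ := exists_lt_of_coe_lt_legendreE (hpos w hwa)
      set δ := (η ⬝ᵥ w - logLaplace μ η - (ξ ⬝ᵥ w - logLaplace μ ξ)) / 2 with hδ
      refine ⟨{z | ξ ⬝ᵥ z - logLaplace μ ξ + δ < η ⬝ᵥ z - logLaplace μ η},
        mem_nhdsWithin_of_mem_nhds (IsOpen.mem_nhds (isOpen_lt ?_ ?_) ?_), δ, by linarith, ?_⟩
      · exact ((continuous_dotProduct_left ξ).sub continuous_const).add continuous_const
      · exact (continuous_dotProduct_left η).sub continuous_const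
      · simp only [Set.mem_ofPred_eq]; linarith
      · intro z hz
        exact le_trans (by exact_mod_cast (le_of_lt hz)) (le_legendreE hη z)
  obtain ⟨δ, hδ, h⟩ := hsphere
  refine ⟨δ, hδ, fun z hz => ?_⟩
  by_cases hzt : legendreE n μ z = ⊤
  · rw [hzt]; exact le_top
  have hz0 : 0 < ‖z - a‖ := hr.trans_le hz
  have hza : z ≠ a := fun h => by simp [h] at hz0
  rcases hz.eq_or_lt with heq | hlt
  · exact h z (by rw [mem_sphere_iff_norm, heq])
  set t := r / ‖z - a‖ with ht
  have ht0 : 0 < t := div_pos hr hz0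
  have ht1 : t < 1 := (div_lt_one hz0).2 hlt
  have hw : t • z + (1 - t) • a ∈ Metric.sphere a r := by
    rw [mem_sphere_iff_norm, show t • z + (1 - t) • a - a = t • (z - a) by module, norm_smul,
      Real.norm_of_nonneg ht0.le, ht, div_mul_cancel₀ _ hz0.ne']
  have h1 := chord z hza hzt t ht0 ht1 _ (h _ hw) (hconv z hzt t ht0 ht1)
  rw [dotProduct_add, dotProduct_smul, dotProduct_smul, smul_eq_mul, smul_eq_mul] at h1
  rw [← EReal.coe_toReal hzt (hbot z)]
  refine EReal.coe_le_coe_iff.2 ?_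
  have h2 : 0 < t * ((legendreE n μ z).toReal - (ξ ⬝ᵥ z - logLaplace μ ξ)) - δ := by linarith
  have h3 : 0 ≤ (legendreE n μ z).toReal - (ξ ⬝ᵥ z - logLaplace μ ξ) := by
    by_contra! hneg
    nlinarith
  nlinarith

/-- If there are couplings of `ν` and `μ` under which the difference of the coordinates
concentrates at `a`, then `ν` is the translate of `μ` by `a`. -/
lemma eq_map_add_of_forall_exists_coupling {ν : Measure (Fin n → ℝ)} [IsProbabilityMeasure ν]
    [IsProbabilityMeasure μ] (a : Fin n → ℝ)
    (h : ∀ r > 0, ∀ ε : ℝ, 0 < ε → ∃ P : Measure ((Fin n → ℝ) × (Fin n → ℝ)),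
      P.map Prod.fst = ν ∧ P.map Prod.snd = μ ∧
        P {p | r ≤ ‖p.1 - p.2 - a‖} ≤ ENNReal.ofReal ε) :
    ν = μ.map (· + a) := by
  have hm : Measurable fun x : Fin n → ℝ => x + a := by fun_prop
  have : IsProbabilityMeasure (μ.map (· + a)) := Measure.isProbabilityMeasure_map hm.aemeasurable
  have h0 : levyProkhorovEDist ν (μ.map (· + a)) ≤ 0 := by
    refine levyProkhorovEDist_le_of_forall_le _ _ 0 fun ε B hε hεt hB => ?_
    have hε' : 0 < ε.toReal := ENNReal.toReal_pos hε.ne' hεt.ne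
    obtain ⟨P, h1, h2, h3⟩ := h ε.toReal hε' ε.toReal hε'
    rw [ENNReal.ofReal_toReal hεt.ne] at h3
    have hth : MeasurableSet (Metric.thickening ε.toReal B) :=
      Metric.isOpen_thickening.measurableSet
    rw [Measure.map_apply hm hth, ← h1, ← h2, Measure.map_apply measurable_fst hB,
      Measure.map_apply measurable_snd (hm hth)]
    refine (measure_mono ?_).trans ((measure_union_le _ _).trans (add_le_add le_rfl h3))
    intro p hp
    by_cases hpr : ε.toReal ≤ ‖p.1 - p.2 - a‖
    · exact Or.inr hpr
    · refine Or.inl (Metric.mem_thickening_iff.2 ⟨p.1, hp, ?_⟩)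
      rw [dist_comm, dist_eq_norm, ← sub_sub]
      exact not_le.1 hpr
  have h0' := le_antisymm h0 bot_le
  refine ext_of_generate_finite _ ?_ isPiSystem_isClosed (fun A hA => ?_) (by simp)
  · rw [BorelSpace.measurable_eq (α := Fin n → ℝ), borel_eq_generateFrom_isClosed]
  exact measure_eq_measure_of_levyProkhorovEDist_eq_zero_of_isClosed h0' hA
    ⟨1, one_pos, measure_ne_top _ _⟩ ⟨1, one_pos, measure_ne_top _ _⟩

lemma integrable_dotProduct {ν : Measure (Fin n → ℝ)} (hi : ∀ i, Integrable (fun x => x i) ν)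
    (ξ : Fin n → ℝ) : Integrable (fun x => ξ ⬝ᵥ x) ν := by
  unfold dotProduct
  exact integrable_finsetSum _ fun i _ => (hi i).const_mul _

lemma integral_dotProduct {ν : Measure (Fin n → ℝ)} (hi : ∀ i, Integrable (fun x => x i) ν)
    (ξ : Fin n → ℝ) : ∫ x, ξ ⬝ᵥ x ∂ν = ξ ⬝ᵥ fun i => ∫ x, x i ∂ν := by
  unfold dotProduct
  rw [integral_finsetSum _ fun i _ => (hi i).const_mul _]
  simp_rw [integral_const_mul]

/-- A coupling with nearly optimal cost concentrates, quantitatively, where the cost is close to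
its supporting affine function. -/
lemma measure_far_le_of_lintegral_le {c : (Fin n → ℝ) → ℝ≥0∞}
    {P : Measure ((Fin n → ℝ) × (Fin n → ℝ))} [IsProbabilityMeasure P]
    {ξ a : Fin n → ℝ} {b r δ ε : ℝ} (hδ : 0 < δ) (hK : 0 ≤ ξ ⬝ᵥ a - b) (hε : 0 < ε)
    (hfst : Integrable (fun p => ξ ⬝ᵥ p.1) P) (hsnd : Integrable (fun p => ξ ⬝ᵥ p.2) P)
    (hmean : ∫ p, ξ ⬝ᵥ p.1 ∂P - ∫ p, ξ ⬝ᵥ p.2 ∂P = ξ ⬝ᵥ a)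
    (hc : ∀ z, ENNReal.ofReal (ξ ⬝ᵥ z - b) ≤ c z)
    (hgap : ∀ z, r ≤ ‖z - a‖ → ENNReal.ofReal (ξ ⬝ᵥ z - b + δ) ≤ c z)
    (hP : ∫⁻ p, c (p.1 - p.2) ∂P ≤ ENNReal.ofReal (ξ ⬝ᵥ a - b + δ * ε)) :
    P {p | r ≤ ‖p.1 - p.2 - a‖} ≤ ENNReal.ofReal ε := by
  set S := {p : (Fin n → ℝ) × (Fin n → ℝ) | r ≤ ‖p.1 - p.2 - a‖} with hS
  have hSm : MeasurableSet S := (isClosed_le continuous_const (by fun_prop)).measurableSet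
  have hi1 : Integrable (fun p : (Fin n → ℝ) × (Fin n → ℝ) => ξ ⬝ᵥ p.1 - ξ ⬝ᵥ p.2 - b) P :=
    (hfst.sub hsnd).sub (integrable_const _)
  have hi2 : Integrable (S.indicator fun _ => δ) P := (integrable_const δ).indicator hSm
  have hval : ∫ p, ((ξ ⬝ᵥ p.1 - ξ ⬝ᵥ p.2 - b) + S.indicator (fun _ => δ) p) ∂P
      = ξ ⬝ᵥ a - b + P.real S * δ := by
    have hi3 : Integrable (fun p : (Fin n → ℝ) × (Fin n → ℝ) => ξ ⬝ᵥ p.1 - ξ ⬝ᵥ p.2) P :=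
      hfst.sub hsnd
    rw [integral_add hi1 hi2, integral_sub hi3 (integrable_const _),
      integral_sub hfst hsnd, hmean, integral_indicator_const _ hSm]
    simp
  have hle : ∫⁻ p, ENNReal.ofReal
      ((ξ ⬝ᵥ p.1 - ξ ⬝ᵥ p.2 - b) + S.indicator (fun _ => δ) p) ∂P
      ≤ ENNReal.ofReal (ξ ⬝ᵥ a - b + δ * ε) := by
    refine (lintegral_mono fun p => ?_).trans hP
    rw [← dotProduct_sub]
    by_cases hp : p ∈ S
    · rw [Set.indicator_of_mem hp]
      exact hgap _ hp
    · rw [Set.indicator_of_notMem hp, add_zero]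
      exact hc _
  have hint := integral_eq_lintegral_pos_part_sub_lintegral_neg_part (hi1.add hi2)
  have h1 := ENNReal.toReal_mono ENNReal.ofReal_ne_top hle
  rw [ENNReal.toReal_ofReal (by positivity)] at h1
  simp only [Pi.add_apply] at hint
  rw [hval] at hint
  have h2 : P.real S * δ ≤ ε * δ := by
    have := ENNReal.toReal_nonneg (a := ∫⁻ p, ENNReal.ofReal
      (-((ξ ⬝ᵥ p.1 - ξ ⬝ᵥ p.2 - b) + S.indicator (fun _ => δ) p)) ∂P)
    linarith
  rw [← ofReal_measureReal]
  exact ENNReal.ofReal_le_ofReal (le_of_mul_le_mul_right h2 hδ)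

section Tilted

/-- The barycenter of the exponential tilt of `μ` by `ξ`. -/
noncomputable def tiltedMean (μ : Measure (Fin n → ℝ)) (ξ : Fin n → ℝ) : Fin n → ℝ :=
  fun i => ∫ x, x i ∂(μ.tilted fun x => ξ ⬝ᵥ x)

lemma integrable_of_mem_interior {ξ : Fin n → ℝ}
    (hξ : ξ ∈ interior {ξ | Integrable (fun x => Real.exp (ξ ⬝ᵥ x)) μ}) :
    Integrable (fun x => Real.exp (ξ ⬝ᵥ x)) μ := by
  simpa using interior_subset hξ

lemma integrable_coord_tilted {ξ : Fin n → ℝ}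
    (hξ : ξ ∈ interior {ξ | Integrable (fun x => Real.exp (ξ ⬝ᵥ x)) μ}) (i : Fin n) :
    Integrable (fun x => x i) (μ.tilted fun x => ξ ⬝ᵥ x) := by
  rw [integrable_tilted_iff (integrable_of_mem_interior hξ)]
  obtain ⟨ε, hε, hball⟩ := Metric.mem_nhds_iff.1 (mem_interior_iff_mem_nhds.1 hξ)
  have hmem : ∀ s : ℝ, |s| = ε / 2 →
      Integrable (fun x => Real.exp ((ξ + Pi.single i s) ⬝ᵥ x)) μ := by
    intro s hs
    refine hball ?_
    rw [mem_ball_iff_norm, add_sub_cancel_left, Pi.norm_single, Real.norm_eq_abs, hs]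
    linarith
  have h1 := hmem (ε / 2) (abs_of_pos (half_pos hε))
  have h2 := hmem (-(ε / 2)) (by rw [abs_neg, abs_of_pos (half_pos hε)])
  refine ((h1.add h2).const_mul (ε / 2)⁻¹).mono' ?_ (ae_of_all _ fun x => ?_)
  · exact (aestronglyMeasurable_exp_dotProduct ξ).smul
      (measurable_pi_apply i).aestronglyMeasurable
  · simp only [Pi.add_apply, add_dotProduct, single_dotProduct, Real.exp_add, smul_eq_mul,
      norm_mul, Real.norm_eq_abs, Real.abs_exp]
    rw [← mul_add, mul_left_comm]
    refine mul_le_mul_of_nonneg_left ?_ (Real.exp_pos _).le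
    rw [le_inv_mul_iff₀ (half_pos hε)]
    have e1 := Real.add_one_le_exp (ε / 2 * x i)
    have e2 := Real.add_one_le_exp (-(ε / 2) * x i)
    have p1 := Real.exp_pos (ε / 2 * x i)
    have p2 := Real.exp_pos (-(ε / 2) * x i)
    rcases abs_cases (x i) with ⟨h, -⟩ | ⟨h, -⟩ <;> rw [h] <;> linarith

/-- The affine function `⟨ξ, ·⟩ - Λ(ξ)` attains the supremum defining `Λ*` at the tilted mean. -/
lemma dotProduct_tiltedMean_sub_le [NeZero μ] {ξ η : Fin n → ℝ}
    (hξ : Integrable (fun x => Real.exp (ξ ⬝ᵥ x)) μ)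
    (hi : ∀ i, Integrable (fun x => x i) (μ.tilted fun x => ξ ⬝ᵥ x))
    (hη : Integrable (fun x => Real.exp (η ⬝ᵥ x)) μ) :
    η ⬝ᵥ tiltedMean μ ξ - logLaplace μ η ≤ ξ ⬝ᵥ tiltedMean μ ξ - logLaplace μ ξ := by
  have : IsProbabilityMeasure (μ.tilted fun x => ξ ⬝ᵥ x) := isProbabilityMeasure_tilted hξ
  have hexp : Integrable (fun x => Real.exp ((η - ξ) ⬝ᵥ x)) (μ.tilted fun x => ξ ⬝ᵥ x) := by
    rw [integrable_tilted_iff hξ]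
    refine hη.congr (ae_of_all _ fun x => ?_)
    simp only [smul_eq_mul, ← Real.exp_add, ← add_dotProduct, add_sub_cancel]
  have hJ := convexOn_exp.map_integral_le (Real.continuous_exp.continuousOn) isClosed_univ
    (ae_of_all _ fun _ => Set.mem_univ _) (integrable_dotProduct hi (η - ξ)) hexp
  have hval : ∫ x, Real.exp ((η - ξ) ⬝ᵥ x) ∂(μ.tilted fun x => ξ ⬝ᵥ x)
      = Real.exp (logLaplace μ η - logLaplace μ ξ) := by
    rw [integral_exp_tilted, Real.exp_sub, logLaplace, logLaplace,
      Real.exp_log (integral_exp_pos hη), Real.exp_log (integral_exp_pos hξ)]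
    congr 2
    ext x
    simp
  rw [integral_dotProduct hi, hval, Real.exp_le_exp, sub_dotProduct] at hJ
  change η ⬝ᵥ tiltedMean μ ξ - ξ ⬝ᵥ tiltedMean μ ξ ≤ _ at hJ
  linarith

lemma legendreE_tiltedMean [NeZero μ] {ξ : Fin n → ℝ}
    (hξ : Integrable (fun x => Real.exp (ξ ⬝ᵥ x)) μ)
    (hi : ∀ i, Integrable (fun x => x i) (μ.tilted fun x => ξ ⬝ᵥ x)) :
    legendreE n μ (tiltedMean μ ξ)
      = ((ξ ⬝ᵥ tiltedMean μ ξ - logLaplace μ ξ : ℝ) : EReal) :=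
  le_antisymm (legendreE_le fun _ hη => dotProduct_tiltedMean_sub_le hξ hi hη)
    (le_legendreE hξ _)

lemma relEntropy_tilted [NeZero μ] [SigmaFinite μ] {ξ : Fin n → ℝ}
    (hξ : Integrable (fun x => Real.exp (ξ ⬝ᵥ x)) μ)
    (hi : ∀ i, Integrable (fun x => x i) (μ.tilted fun x => ξ ⬝ᵥ x)) :
    relEntropy (μ.tilted fun x => ξ ⬝ᵥ x) μ
      = ENNReal.ofReal (ξ ⬝ᵥ tiltedMean μ ξ - logLaplace μ ξ) := by
  have : IsProbabilityMeasure (μ.tilted fun x => ξ ⬝ᵥ x) := isProbabilityMeasure_tilted hξ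
  have hac := tilted_absolutelyContinuous μ fun x => ξ ⬝ᵥ x
  have hae := hac.ae_le (log_rnDeriv_tilted_left_self hξ)
  have hint : Integrable (fun x => ξ ⬝ᵥ x - Real.log (∫ x, Real.exp (ξ ⬝ᵥ x) ∂μ))
      (μ.tilted fun x => ξ ⬝ᵥ x) := (integrable_dotProduct hi ξ).sub (integrable_const _)
  rw [relEntropy, if_pos ⟨hac, hint.congr (Filter.EventuallyEq.symm hae)⟩, integral_congr_ae hae,
    integral_sub (integrable_dotProduct hi ξ) (integrable_const _), integral_dotProduct hi]
  simp only [logLaplace, integral_const, probReal_univ, smul_eq_mul, one_mul]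
  rfl

lemma ofReal_le_eRealToENN {K : ℝ} {x : EReal} (h : (K : EReal) ≤ x) :
    ENNReal.ofReal K ≤ eRealToENN x := by
  unfold eRealToENN
  split_ifs with hx
  · exact le_top
  · have := EReal.toReal_le_toReal h (EReal.coe_ne_bot _) hx
    exact ENNReal.ofReal_le_ofReal (by rwa [EReal.toReal_coe] at this)

/-- Equality in Jensen's inequality: the exponential tilts of `μ` are its translates. -/
lemma tilted_eq_map_add [IsProbabilityMeasure μ] (hmi : ∀ i, Integrable (fun x => x i) μ)
    (hmean : ∀ i, ∫ x, x i ∂μ = 0)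
    (hstrict : ∀ x ∈ {x : Fin n → ℝ | legendreE n μ x ≠ ⊤},
      ∀ y ∈ {x : Fin n → ℝ | legendreE n μ x ≠ ⊤}, x ≠ y → ∀ t : ℝ, 0 < t → t < 1 →
      (legendreE n μ (t • x + (1 - t) • y)).toReal <
        t * (legendreE n μ x).toReal + (1 - t) * (legendreE n μ y).toReal)
    (hTE : ∀ ν : Measure (Fin n → ℝ), IsProbabilityMeasure ν →
      transportCost (fun x y => eRealToENN (legendreE n μ (x - y))) ν μ ≤ relEntropy ν μ)
    {ξ : Fin n → ℝ} (hξ : ξ ∈ interior {ξ | Integrable (fun x => Real.exp (ξ ⬝ᵥ x)) μ}) :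
    μ.tilted (fun x => ξ ⬝ᵥ x) = μ.map (· + tiltedMean μ ξ) := by
  have hi := integrable_coord_tilted hξ
  have hξ' : Integrable (fun x => Real.exp (ξ ⬝ᵥ x)) μ :=
    integrable_of_mem_interior hξ
  have : IsProbabilityMeasure (μ.tilted fun x => ξ ⬝ᵥ x) := isProbabilityMeasure_tilted hξ'
  have hleg := legendreE_tiltedMean hξ' hi
  have hK : 0 ≤ ξ ⬝ᵥ tiltedMean μ ξ - logLaplace μ ξ := by
    have := dotProduct_tiltedMean_sub_le (η := 0) hξ' hi (by simp)
    simpa [logLaplace] using this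
  refine eq_map_add_of_forall_exists_coupling _ fun r hr ε hε => ?_
  obtain ⟨δ, hδ, hgap⟩ := exists_gap_legendreE hξ' hleg hstrict hr
  have hlt : transportCost (fun x y => eRealToENN (legendreE n μ (x - y)))
      (μ.tilted fun x => ξ ⬝ᵥ x) μ
      < ENNReal.ofReal (ξ ⬝ᵥ tiltedMean μ ξ - logLaplace μ ξ + δ * ε) := by
    refine (hTE _ inferInstance).trans_lt ?_
    rw [relEntropy_tilted hξ' hi]
    exact (ENNReal.ofReal_lt_ofReal_iff (by positivity)).2 (by linarith [mul_pos hδ hε])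
  unfold transportCost at hlt
  simp only [iInf_lt_iff] at hlt
  obtain ⟨P, h1, h2, hP⟩ := hlt
  refine ⟨P, h1, h2, ?_⟩
  have : IsProbabilityMeasure P := ⟨by
    have := measure_univ (μ := μ)
    rwa [← h2, Measure.map_apply measurable_snd .univ, Set.preimage_univ] at this⟩
  have hfst : Integrable (fun p => ξ ⬝ᵥ p.1) P := by
    have := integrable_dotProduct hi ξ
    rw [← h1] at this
    exact this.comp_measurable measurable_fst
  have hsnd : Integrable (fun p => ξ ⬝ᵥ p.2) P := by
    have := integrable_dotProduct hmi ξ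
    rw [← h2] at this
    exact this.comp_measurable measurable_snd
  refine measure_far_le_of_lintegral_le (c := fun z => eRealToENN (legendreE n μ z)) hδ hK hε
    hfst hsnd ?_ (fun z => ofReal_le_eRealToENN (le_legendreE hξ' z))
    (fun z hz => ofReal_le_eRealToENN (hgap z hz)) hP.le
  have e1 : ∫ p, ξ ⬝ᵥ p.1 ∂P = ξ ⬝ᵥ tiltedMean μ ξ := by
    rw [← integral_map (φ := Prod.fst) (f := fun x => ξ ⬝ᵥ x) measurable_fst.aemeasurable
      (continuous_dotProduct_left ξ).aestronglyMeasurable, h1, integral_dotProduct hi]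
    rfl
  have e2 : ∫ p, ξ ⬝ᵥ p.2 ∂P = 0 := by
    rw [← integral_map (φ := Prod.snd) (f := fun x => ξ ⬝ᵥ x) measurable_snd.aemeasurable
      (continuous_dotProduct_left ξ).aestronglyMeasurable, h2, integral_dotProduct hmi]
    simp [hmean, dotProduct]
  rw [e1, e2, sub_zero]

end Tilted

/-- The Laplace transform, with values in `[0, ∞]`. -/
noncomputable def laplaceENN (μ : Measure (Fin n → ℝ)) (ξ : Fin n → ℝ) : ℝ≥0∞ :=
  ∫⁻ x, ENNReal.ofReal (Real.exp (ξ ⬝ᵥ x)) ∂μ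

lemma laplaceENN_ne_top_iff (ξ : Fin n → ℝ) :
    laplaceENN μ ξ ≠ ⊤ ↔ Integrable (fun x => Real.exp (ξ ⬝ᵥ x)) μ := by
  rw [← logLaplaceE_ne_top_iff, logLaplaceE, Ne, Ne, ENNReal.log_eq_top_iff]
  rfl

lemma laplaceENN_eq_ofReal_exp [NeZero μ] {ξ : Fin n → ℝ}
    (h : Integrable (fun x => Real.exp (ξ ⬝ᵥ x)) μ) :
    laplaceENN μ ξ = ENNReal.ofReal (Real.exp (logLaplace μ ξ)) := by
  rw [logLaplace, Real.exp_log (integral_exp_pos h),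
    ofReal_integral_eq_lintegral_ofReal h (ae_of_all _ fun x => (Real.exp_pos _).le)]
  rfl

lemma laplaceENN_add_of_tilted_eq [NeZero μ] {ξ a : Fin n → ℝ}
    (hξ : Integrable (fun x => Real.exp (ξ ⬝ᵥ x)) μ)
    (h : μ.tilted (fun x => ξ ⬝ᵥ x) = μ.map (· + a)) (η : Fin n → ℝ) :
    laplaceENN μ (ξ + η) = ENNReal.ofReal (Real.exp (logLaplace μ ξ + η ⬝ᵥ a)) *
      laplaceENN μ η := by
  have hm : Measurable fun x => ENNReal.ofReal (Real.exp (η ⬝ᵥ x)) :=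
    ENNReal.measurable_ofReal.comp (Real.measurable_exp.comp (measurable_dotProduct_left η))
  have h1 : ∫⁻ x, ENNReal.ofReal (Real.exp (η ⬝ᵥ x)) ∂(μ.tilted fun x => ξ ⬝ᵥ x)
      = ENNReal.ofReal (Real.exp (-logLaplace μ ξ)) * laplaceENN μ (ξ + η) := by
    rw [lintegral_tilted, laplaceENN, ← lintegral_const_mul' _ _ ENNReal.ofReal_ne_top]
    refine lintegral_congr fun x => ?_
    rw [← ENNReal.ofReal_mul (by positivity), ← ENNReal.ofReal_mul (by positivity),
      Real.exp_neg, logLaplace, Real.exp_log (integral_exp_pos hξ), add_dotProduct, Real.exp_add]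
    congr 1
    ring
  have h2 : ∫⁻ x, ENNReal.ofReal (Real.exp (η ⬝ᵥ x)) ∂(μ.map (· + a))
      = ENNReal.ofReal (Real.exp (η ⬝ᵥ a)) * laplaceENN μ η := by
    rw [lintegral_map hm (by fun_prop), laplaceENN,
      ← lintegral_const_mul' _ _ ENNReal.ofReal_ne_top]
    refine lintegral_congr fun x => ?_
    rw [← ENNReal.ofReal_mul (by positivity), dotProduct_add, Real.exp_add, mul_comm]
  rw [h, h2] at h1
  rw [Real.exp_add, ENNReal.ofReal_mul (by positivity), mul_assoc, h1, ← mul_assoc,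
    ← ENNReal.ofReal_mul (by positivity), ← Real.exp_add]
  simp

/-- A subset of `ℝⁿ` containing `0`, with nonempty interior and invariant under translation by the
points of its interior, is everything. -/
lemma interior_eq_univ_of_add_mem_iff {D : Set (Fin n → ℝ)} (h0 : 0 ∈ D)
    (hne : (interior D).Nonempty) (h : ∀ ξ ∈ interior D, ∀ η, ξ + η ∈ D ↔ η ∈ D) :
    interior D = univ := by
  obtain ⟨ξ₀, hξ₀⟩ := hne
  have h0i : D ∈ nhds (0 : Fin n → ℝ) := by
    have hc : Filter.Tendsto (fun η => ξ₀ + η) (nhds 0) (nhds ξ₀) :=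
      (by fun_prop : Continuous fun η : Fin n → ℝ => ξ₀ + η).tendsto' _ _ (add_zero _)
    filter_upwards [hc (mem_interior_iff_mem_nhds.1 hξ₀)] with η hη
    exact (h ξ₀ hξ₀ η).1 hη
  have hmul : ∀ ξ ∈ interior D, ∀ k : ℕ, k • ξ ∈ D := by
    intro ξ hξ k
    induction k with
    | zero => simpa using h0
    | succ k ih => rw [succ_nsmul']; exact (h ξ hξ _).2 ih
  have huniv : D = univ := by
    refine Set.eq_univ_of_forall fun x => ?_
    have hc : Filter.Tendsto (fun k : ℕ => ((k : ℝ)⁻¹) • x) Filter.atTop (nhds 0) := by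
      simpa using (tendsto_inv_atTop_nhds_zero_nat (𝕜 := ℝ)).smul_const x
    obtain ⟨k, hk, hk0⟩ := ((hc.eventually (interior_mem_nhds.2 h0i)).and
      (Filter.eventually_gt_atTop 0)).exists
    have := hmul _ hk k
    rwa [← Nat.cast_smul_eq_nsmul ℝ, smul_smul, mul_inv_cancel₀ (by positivity), one_smul] at this
  rw [huniv, interior_univ]

/-- If `Λ ≥ 0` and `Λ(ξ + η) - Λ(ξ) - Λ(η) = ⟨η, m(ξ)⟩`, then `Λ` is half a quadratic form. -/
lemma exists_posSemidef_of_add_eq {Λ : (Fin n → ℝ) → ℝ} {m : (Fin n → ℝ) → Fin n → ℝ}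
    (hnn : ∀ ξ, 0 ≤ Λ ξ) (h : ∀ ξ η, Λ (ξ + η) = Λ ξ + Λ η + η ⬝ᵥ m ξ) :
    ∃ A : Matrix (Fin n) (Fin n) ℝ, A.PosSemidef ∧
      ∀ ξ, Λ ξ = (∑ i, ∑ j, ξ i * A i j * ξ j) / 2 := by
  have hsymm : ∀ ξ η, η ⬝ᵥ m ξ = ξ ⬝ᵥ m η := fun ξ η => by
    have h1 := h ξ η
    have h2 := h η ξ
    rw [add_comm η ξ] at h2
    linarith
  set A : Matrix (Fin n) (Fin n) ℝ := Matrix.of fun i => m (Pi.single i 1) with hA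
  have hm : ∀ ξ, m ξ = A.mulVec ξ := fun ξ => by
    ext i
    have := hsymm ξ (Pi.single i 1)
    rw [single_one_dotProduct, dotProduct_comm] at this
    exact this
  have h0 : Λ 0 = 0 := by
    have := h 0 0
    simp at this
    exact this
  have hB : ∀ ξ, Λ ξ + Λ (-ξ) = ξ ⬝ᵥ A.mulVec ξ := fun ξ => by
    have := h ξ (-ξ)
    rw [add_neg_cancel, h0, hm, neg_dotProduct] at this
    linarith
  have hpsd : A.PosSemidef := by
    refine Matrix.PosSemidef.of_dotProduct_mulVec_nonneg ?_ fun ξ => ?_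
    · ext i j
      have := hsymm (Pi.single i 1) (Pi.single j 1)
      rw [single_one_dotProduct, single_one_dotProduct] at this
      simpa [hA] using this.symm
    · rw [star_trivial, ← hB]
      exact add_nonneg (hnn _) (hnn _)
  refine ⟨A, hpsd, fun ξ => ?_⟩
  have hsum : ∀ ξ : Fin n → ℝ, ∑ i, ∑ j, ξ i * A i j * ξ j = ξ ⬝ᵥ A.mulVec ξ := fun ξ => by
    simp only [dotProduct, Matrix.mulVec, Finset.mul_sum, mul_assoc]
  rw [hsum]
  -- the remainder `Λ - B / 2` is additive and bounded below by a quadratic form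
  let q : (Fin n → ℝ) →+ ℝ := AddMonoidHom.mk' (fun ξ => Λ ξ - ξ ⬝ᵥ A.mulVec ξ / 2) fun ξ η => by
    have := hsymm ξ η
    simp only [hm] at this
    simp only [h, hm, Matrix.mulVec_add, dotProduct_add, add_dotProduct]
    linarith
  have hq : ∀ ξ, q ξ = Λ ξ - ξ ⬝ᵥ A.mulVec ξ / 2 := fun ξ => rfl
  have hqnn : ∀ ξ, 0 ≤ q ξ := fun ξ => by
    by_contra! hneg
    obtain ⟨k, hk⟩ := exists_nat_gt (ξ ⬝ᵥ A.mulVec ξ / (2 * -q ξ))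
    have hBnn : 0 ≤ ξ ⬝ᵥ A.mulVec ξ := by rw [← hB]; exact add_nonneg (hnn _) (hnn _)
    have hk0 : (0 : ℝ) < k := lt_of_le_of_lt (div_nonneg hBnn (by linarith)) hk
    rw [div_lt_iff₀ (by linarith)] at hk
    have h1 : q ξ = k * q ((k : ℝ)⁻¹ • ξ) := by
      rw [← nsmul_eq_mul, ← map_nsmul, ← Nat.cast_smul_eq_nsmul ℝ, smul_smul,
        mul_inv_cancel₀ hk0.ne', one_smul]
    have h2 : q ((k : ℝ)⁻¹ • ξ) ≥ -((k : ℝ)⁻¹ * ((k : ℝ)⁻¹ * (ξ ⬝ᵥ A.mulVec ξ)) / 2) := by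
      rw [hq, Matrix.mulVec_smul, dotProduct_smul, smul_dotProduct, smul_eq_mul, smul_eq_mul]
      linarith [hnn ((k : ℝ)⁻¹ • ξ)]
    have h3 := mul_le_mul_of_nonneg_left h2 (mul_nonneg hk0.le hk0.le)
    have h4 : (k : ℝ) * k * -((k : ℝ)⁻¹ * ((k : ℝ)⁻¹ * (ξ ⬝ᵥ A.mulVec ξ)) / 2)
        = -(ξ ⬝ᵥ A.mulVec ξ / 2) := by field_simp
    rw [h4, mul_assoc, ← h1] at h3
    linarith
  have h5 := hqnn ξ
  have h6 := hqnn (-ξ)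
  rw [map_neg] at h6
  have h7 := hq ξ
  linarith

lemma logLaplace_nonneg [IsProbabilityMeasure μ] (hmi : ∀ i, Integrable (fun x => x i) μ)
    (hmean : ∀ i, ∫ x, x i ∂μ = 0) {ξ : Fin n → ℝ}
    (hξ : Integrable (fun x => Real.exp (ξ ⬝ᵥ x)) μ) : 0 ≤ logLaplace μ ξ := by
  refine Real.log_nonneg ?_
  have h1 : ∫ x, (ξ ⬝ᵥ x + 1) ∂μ ≤ ∫ x, Real.exp (ξ ⬝ᵥ x) ∂μ :=
    integral_mono ((integrable_dotProduct hmi ξ).add (integrable_const _)) hξ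
      fun x => Real.add_one_le_exp _
  rw [integral_add (integrable_dotProduct hmi ξ) (integrable_const _),
    integral_dotProduct hmi] at h1
  simpa [hmean, dotProduct] using h1

end Preliminaries

/-- **Only Gaussian measures saturate the quadratic-type cost.** Let `μ` be a centered
probability measure on `ℝⁿ` whose log-Laplace transform `Λ_μ` has a domain with nonempty
interior, and whose Legendre transform `Λ*_μ` is strictly convex on its domain. If `μ`
satisfies the transportation-entropy inequality with cost `c(x,y) = Λ*_μ(x-y)`, then `μ`
is a centered Gaussian measure, i.e. `Λ_μ` is a positive semi-definite quadratic form. -/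
theorem gaussian_of_transport_entropy (n : ℕ) (μ : Measure (Fin n → ℝ))
    [IsProbabilityMeasure μ]
    (hmi : ∀ i, Integrable (fun x => x i) μ) (hmean : ∀ i, ∫ x, x i ∂μ = 0)
    (hdom : (interior {ξ : Fin n → ℝ | logLaplaceE n μ ξ ≠ ⊤}).Nonempty)
    (hstrict : ∀ x ∈ {x : Fin n → ℝ | legendreE n μ x ≠ ⊤},
      ∀ y ∈ {x : Fin n → ℝ | legendreE n μ x ≠ ⊤}, x ≠ y → ∀ t : ℝ, 0 < t → t < 1 →
      (legendreE n μ (t • x + (1 - t) • y)).toReal <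
        t * (legendreE n μ x).toReal + (1 - t) * (legendreE n μ y).toReal)
    (hTE : ∀ ν : Measure (Fin n → ℝ), IsProbabilityMeasure ν →
      transportCost (fun x y => eRealToENN (legendreE n μ (x - y))) ν μ ≤ relEntropy ν μ) :
    ∃ A : Matrix (Fin n) (Fin n) ℝ, A.PosSemidef ∧
      ∀ ξ, logLaplaceE n μ ξ = (((∑ i, ∑ j, ξ i * A i j * ξ j) / 2 : ℝ) : EReal) := by
  have hD : {ξ : Fin n → ℝ | logLaplaceE n μ ξ ≠ ⊤}
      = {ξ | Integrable (fun x => Real.exp (ξ ⬝ᵥ x)) μ} :=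
    Set.ext fun ξ => logLaplaceE_ne_top_iff ξ
  rw [hD] at hdom
  have htilt := fun ξ hξ => tilted_eq_map_add hmi hmean hstrict hTE (ξ := ξ) hξ
  have huniv : interior {ξ | Integrable (fun x => Real.exp (ξ ⬝ᵥ x)) μ} = univ := by
    refine interior_eq_univ_of_add_mem_iff (by simp) hdom fun ξ hξ η => ?_
    have := laplaceENN_add_of_tilted_eq (integrable_of_mem_interior hξ) (htilt ξ hξ) η
    simp only [Set.mem_ofPred_eq, ← laplaceENN_ne_top_iff, this]
    refine not_congr ⟨fun h => ?_, fun h => ?_⟩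
    · by_contra hne
      exact ENNReal.mul_ne_top ENNReal.ofReal_ne_top hne h
    · rw [h, ENNReal.mul_top (ENNReal.ofReal_pos.2 (Real.exp_pos _)).ne']
  have hint : ∀ ξ : Fin n → ℝ, Integrable (fun x => Real.exp (ξ ⬝ᵥ x)) μ := fun ξ =>
    integrable_of_mem_interior (huniv.symm ▸ Set.mem_univ ξ)
  obtain ⟨A, hA, h⟩ := exists_posSemidef_of_add_eq (Λ := logLaplace μ) (m := tiltedMean μ)
    (fun ξ => logLaplace_nonneg hmi hmean (hint ξ)) fun ξ η => by
      have := laplaceENN_add_of_tilted_eq (hint ξ) (htilt ξ (huniv.symm ▸ Set.mem_univ ξ)) η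
      rw [laplaceENN_eq_ofReal_exp (hint _), laplaceENN_eq_ofReal_exp (hint _),
        ← ENNReal.ofReal_mul (by positivity), ← Real.exp_add,
        ENNReal.ofReal_eq_ofReal_iff (by positivity) (by positivity), Real.exp_eq_exp] at this
      linarith
  exact ⟨A, hA, fun ξ => by rw [logLaplaceE_eq_coe (hint ξ), h ξ]⟩
end
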